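/- arXiv:2511.06543 — 2 statements merged into one kernel-verified Lean document; each statement's English description precedes it below -/
import Mathlib

section
/- Let K be a compact subset of the unit circle of arclength (Lebesgue) measure 0, let φ : K → ℂ be continuous with |φ(z)| = 1 for all z ∈ K, and let ε > 0. Then there exists a finite Blaschke product B such that |B(z) − φ(z)| < ε for all z ∈ K. -/
open Complex Metric MeasureTheory Filter Set

noncomputable section

/-- A finite Blaschke product: a unimodular constant times a finite product of
disc automorphisms `z ↦ (z - wₖ)/(1 - conj wₖ · z)` with `wₖ` in the open unit disc. -/
def IsFiniteBlaschke (B : ℂ → ℂ) : Prop :=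
  ∃ (n : ℕ) (ζ : ℂ) (w : Fin (n + 1) → ℂ),
    ‖ζ‖ = 1 ∧ (∀ k, ‖w k‖ < 1) ∧
    ∀ z : ℂ, B z = ζ * ∏ k, (z - w k) / (1 - (starRingEnd ℂ) (w k) * z)

/-- Arclength measure on the unit circle, viewed as a measure on `ℂ`. -/
def arclength : Measure ℂ :=
  Measure.map (circleMap 0 1) (volume.restrict (Set.Ioc 0 (2 * Real.pi)))

/-- A product of linear factors `(x - ω) / conj (x - ω)` on the real line, with all `ω` in the
open upper half-plane, times a unimodular constant: a finite Blaschke product of the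
upper half-plane, restricted to the real line. -/
def IsRealLineBlaschke (g : ℝ → ℂ) : Prop :=
  ∃ (ζ : ℂ) (s : Multiset ℂ), ‖ζ‖ = 1 ∧ (∀ ω ∈ s, 0 < ω.im) ∧
    ∀ x : ℝ, g x = ζ * (s.map fun ω => ((x : ℂ) - ω) / (starRingEnd ℂ) ((x : ℂ) - ω)).prod

/-- Uniform approximability on `K ⊆ ℝ` by finite Blaschke products of the upper half-plane. -/
def IsBlaschkeApproximable {K : Set ℝ} (ψ : K → Circle) : Prop :=
  ∀ ε : ℝ, 0 < ε → ∃ g : ℝ → ℂ, IsRealLineBlaschke g ∧ ∀ x : K, ‖g x - ψ x‖ < ε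

lemma ofReal_sub_ne_zero_of_im_pos {ω : ℂ} (hω : 0 < ω.im) (x : ℝ) : (x : ℂ) - ω ≠ 0 := by
  intro h
  have := congrArg Complex.im h
  simp at this
  linarith

lemma IsRealLineBlaschke.norm_eq_one {g : ℝ → ℂ} (hg : IsRealLineBlaschke g) (x : ℝ) :
    ‖g x‖ = 1 := by
  obtain ⟨ζ, s, hζ, hs, h⟩ := hg
  rw [h, norm_mul, hζ, one_mul]
  clear h
  induction s using Multiset.induction_on with
  | empty => simp
  | cons ω s ih =>
    rw [Multiset.map_cons, Multiset.prod_cons, norm_mul,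
      ih fun ω hω => hs ω (Multiset.mem_cons_of_mem hω), norm_div, RCLike.norm_conj, div_self,
      one_mul]
    exact norm_ne_zero_iff.2
      (ofReal_sub_ne_zero_of_im_pos (hs ω (Multiset.mem_cons_self ω s)) x)

lemma IsRealLineBlaschke.mul {g h : ℝ → ℂ} (hg : IsRealLineBlaschke g)
    (hh : IsRealLineBlaschke h) : IsRealLineBlaschke fun x => g x * h x := by
  obtain ⟨ζ, s, hζ, hs, hg⟩ := hg
  obtain ⟨ξ, t, hξ, ht, hh⟩ := hh
  refine ⟨ζ * ξ, s + t, by simp [hζ, hξ], fun ω hω => ?_, fun x => ?_⟩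
  · rcases Multiset.mem_add.1 hω with h | h
    exacts [hs ω h, ht ω h]
  · simp only [hg, hh]
    rw [Multiset.map_add, Multiset.prod_add]
    ring

lemma isRealLineBlaschke_const {c : ℂ} (hc : ‖c‖ = 1) : IsRealLineBlaschke fun _ => c :=
  ⟨c, 0, hc, by simp, by simp⟩

lemma isRealLineBlaschke_polynomial {N : Polynomial ℂ} (hN : N ≠ 0)
    (hroots : ∀ ω, N.eval ω = 0 → 0 < ω.im) {c : ℂ} (hc : ‖c‖ = 1) :
    IsRealLineBlaschke fun x => c * (N.eval (x : ℂ) / (starRingEnd ℂ) (N.eval (x : ℂ))) := by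
  have hl : N.leadingCoeff ≠ 0 := Polynomial.leadingCoeff_ne_zero.2 hN
  refine ⟨c * (N.leadingCoeff / (starRingEnd ℂ) N.leadingCoeff), N.roots, ?_, fun ω hω => ?_,
    fun x => ?_⟩
  · rw [norm_mul, norm_div, RCLike.norm_conj, div_self (norm_ne_zero_iff.2 hl), hc, one_mul]
  · exact hroots ω (Polynomial.mem_roots hN |>.1 hω)
  · have heval : N.eval (x : ℂ) =
        N.leadingCoeff * (N.roots.map fun ω => (x : ℂ) - ω).prod := by
      conv_lhs => rw [(IsAlgClosed.splits N).eq_prod_roots]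
      simp [Polynomial.eval_multiset_prod, Multiset.map_map]
    simp only [heval]
    rw [Multiset.prod_map_div, map_mul, map_multiset_prod, Multiset.map_map, mul_assoc,
      div_mul_div_comm]
    rfl

lemma IsBlaschkeApproximable.mul {K : Set ℝ} {ψ χ : K → Circle} (hψ : IsBlaschkeApproximable ψ)
    (hχ : IsBlaschkeApproximable χ) : IsBlaschkeApproximable (ψ * χ) := by
  intro ε hε
  obtain ⟨g, hg, hgψ⟩ := hψ (ε / 2) (half_pos hε)
  obtain ⟨h, hh, hhχ⟩ := hχ (ε / 2) (half_pos hε)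
  refine ⟨_, hg.mul hh, fun x => ?_⟩
  calc ‖g x * h x - ((ψ * χ) x : Circle)‖
      = ‖g x * (h x - χ x) + (g x - ψ x) * χ x‖ := by
        congr 1
        simp only [Pi.mul_apply, Circle.coe_mul]
        ring
    _ ≤ ‖g x‖ * ‖h x - χ x‖ + ‖g x - ψ x‖ * ‖(χ x : ℂ)‖ := by
        rw [← norm_mul, ← norm_mul]
        exact norm_add_le _ _
    _ = ‖h x - χ x‖ + ‖g x - ψ x‖ := by rw [hg.norm_eq_one, Circle.norm_coe, one_mul, mul_one]
    _ < ε := by linarith [hgψ x, hhχ x]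

lemma IsBlaschkeApproximable.prod {K : Set ℝ} {ι : Type*} (s : Finset ι) {ψ : ι → K → Circle}
    (h : ∀ i ∈ s, IsBlaschkeApproximable (ψ i)) : IsBlaschkeApproximable (∏ i ∈ s, ψ i) := by
  refine Finset.prod_induction _ _ (fun _ _ => IsBlaschkeApproximable.mul) ?_ h
  exact fun ε hε => ⟨_, isRealLineBlaschke_const (c := 1) (by simp), fun x => by simpa using hε⟩

/-- A finite family of intervals with closures in `V` which covers `A` can be merged into one whose
closed intervals are pairwise disjoint. -/
lemma exists_pairwiseDisjoint_Icc_of_cover {A V : Set ℝ} (s : Finset (ℝ × ℝ))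
    (hlt : ∀ p ∈ s, p.1 < p.2) (hV : ∀ p ∈ s, Icc p.1 p.2 ⊆ V)
    (hA : A ⊆ ⋃ p ∈ s, Ioo p.1 p.2) :
    ∃ t : Finset (ℝ × ℝ), (∀ p ∈ t, p.1 < p.2) ∧ (∀ p ∈ t, Icc p.1 p.2 ⊆ V) ∧
      (A ⊆ ⋃ p ∈ t, Ioo p.1 p.2) ∧
      (t : Set (ℝ × ℝ)).PairwiseDisjoint fun p => Icc p.1 p.2 := by
  classical
  induction hn : s.card using Nat.strong_induction_on generalizing s with
  | _ n ih =>
  by_cases hd : (s : Set (ℝ × ℝ)).PairwiseDisjoint fun p => Icc p.1 p.2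
  · exact ⟨s, hlt, hV, hA, hd⟩
  obtain ⟨p, hp, q, hq, hpq, hnd⟩ : ∃ p ∈ s, ∃ q ∈ s, p ≠ q ∧
      ¬ Disjoint (Icc p.1 p.2) (Icc q.1 q.2) := by
    simpa [Set.PairwiseDisjoint, Set.Pairwise, Function.onFun] using hd
  obtain ⟨y, hyp, hyq⟩ := Set.not_disjoint_iff.1 hnd
  set r : ℝ × ℝ := (min p.1 q.1, max p.2 q.2) with hr
  refine ih _ ?_ (insert r ((s.erase p).erase q)) ?_ ?_ ?_ rfl
  · have h1 := Finset.card_insert_le r ((s.erase p).erase q)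
    have h2 : ((s.erase p).erase q).card = s.card - 1 - 1 := by
      rw [Finset.card_erase_of_mem (Finset.mem_erase.2 ⟨hpq.symm, hq⟩),
        Finset.card_erase_of_mem hp]
    have h3 : 1 < s.card := Finset.one_lt_card.2 ⟨p, hp, q, hq, hpq⟩
    omega
  · intro a ha
    rcases Finset.mem_insert.1 ha with rfl | ha
    · exact (min_le_left _ _).trans_lt ((hlt p hp).trans_le (le_max_left _ _))
    · exact hlt a (Finset.mem_of_mem_erase (Finset.mem_of_mem_erase ha))
  · intro a ha
    rcases Finset.mem_insert.1 ha with rfl | ha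
    · intro x hx
      rcases le_total x y with hxy | hxy
      · rcases min_le_iff.1 hx.1 with h | h
        · exact hV p hp ⟨h, hxy.trans hyp.2⟩
        · exact hV q hq ⟨h, hxy.trans hyq.2⟩
      · rcases le_max_iff.1 hx.2 with h | h
        · exact hV p hp ⟨hyp.1.trans hxy, h⟩
        · exact hV q hq ⟨hyq.1.trans hxy, h⟩
    · exact hV a (Finset.mem_of_mem_erase (Finset.mem_of_mem_erase ha))
  · intro x hx
    obtain ⟨a, ha, hxa⟩ := mem_iUnion₂.1 (hA hx)
    by_cases hap : a = p
    · subst hap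
      exact mem_iUnion₂.2 ⟨r, Finset.mem_insert_self _ _, (min_le_left _ _).trans_lt hxa.1,
        hxa.2.trans_le (le_max_left _ _)⟩
    by_cases haq : a = q
    · subst haq
      exact mem_iUnion₂.2 ⟨r, Finset.mem_insert_self _ _, (min_le_right _ _).trans_lt hxa.1,
        hxa.2.trans_le (le_max_right _ _)⟩
    · exact mem_iUnion₂.2 ⟨a, Finset.mem_insert_of_mem
        (Finset.mem_erase.2 ⟨haq, Finset.mem_erase.2 ⟨hap, ha⟩⟩), hxa⟩

lemma IsCompact.exists_pairwiseDisjoint_Icc_cover {A V : Set ℝ} (hA : IsCompact A) (hV : IsOpen V)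
    (hAV : A ⊆ V) :
    ∃ t : Finset (ℝ × ℝ), (∀ p ∈ t, p.1 < p.2) ∧ (∀ p ∈ t, Icc p.1 p.2 ⊆ V) ∧
      (A ⊆ ⋃ p ∈ t, Ioo p.1 p.2) ∧
      (t : Set (ℝ × ℝ)).PairwiseDisjoint fun p => Icc p.1 p.2 := by
  classical
  have key : ∀ x : A, ∃ p : ℝ × ℝ, (x : ℝ) ∈ Ioo p.1 p.2 ∧ Icc p.1 p.2 ⊆ V := by
    intro x
    obtain ⟨r, hr, hrV⟩ := Metric.isOpen_iff.1 hV x (hAV x.2)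
    refine ⟨(x - r / 2, x + r / 2), ⟨by simp; linarith, by simp; linarith⟩, fun y hy => hrV ?_⟩
    rw [Metric.mem_ball, Real.dist_eq, abs_lt]
    constructor <;> linarith [hy.1, hy.2]
  choose p hp hpV using key
  obtain ⟨u, hu⟩ := hA.elim_finite_subcover (fun x : A => Ioo (p x).1 (p x).2)
    (fun x => isOpen_Ioo) fun x hx => mem_iUnion.2 ⟨⟨x, hx⟩, hp ⟨x, hx⟩⟩
  refine exists_pairwiseDisjoint_Icc_of_cover (u.image p) ?_ ?_ ?_
  · simp only [Finset.mem_image]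
    rintro _ ⟨x, -, rfl⟩
    exact (hp x).1.trans (hp x).2
  · simp only [Finset.mem_image]
    rintro _ ⟨x, -, rfl⟩
    exact hpV x
  · intro x hx
    obtain ⟨y, hy, hxy⟩ := mem_iUnion₂.1 (hu hx)
    exact mem_iUnion₂.2 ⟨p y, Finset.mem_image_of_mem p hy, hxy⟩

lemma div_pos_of_disjoint_Icc {a b c d : ℝ} (hab : a < b)
    (h : Disjoint (Icc a b) (Icc c d)) {x : ℝ} (hx : x ∈ Icc c d) : 0 < (x - a) / (x - b) := by
  have hxab : x ∉ Icc a b := fun h' => Set.disjoint_left.1 h h' hx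
  rcases lt_or_ge x a with h1 | h1
  · exact div_pos_of_neg_of_neg (by linarith) (by linarith)
  · have : b < x := by
      by_contra! h2
      exact hxab ⟨h1, h2⟩
    exact div_pos (by linarith) (by linarith)

/-- Partial fraction expansion of `1 - ∏ (w - a) / (w - b)` over disjoint intervals `[a, b]`. -/
lemma exists_partialFractions_one_sub_prod (t : Finset (ℝ × ℝ)) (hlt : ∀ p ∈ t, p.1 < p.2)
    (hd : (t : Set (ℝ × ℝ)).PairwiseDisjoint fun p => Icc p.1 p.2) :
    ∃ c : ℝ × ℝ → ℝ, (∀ p ∈ t, 0 < c p) ∧ ∑ p ∈ t, c p = ∑ p ∈ t, (p.2 - p.1) ∧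
      ∀ w : ℂ, (∀ p ∈ t, w ≠ (p.2 : ℂ)) →
        1 - ∏ p ∈ t, (w - p.1) / (w - p.2) = ∑ p ∈ t, (c p : ℂ) / (p.2 - w) := by
  classical
  induction t using Finset.induction_on with
  | empty => exact ⟨fun _ => 1, by simp, by simp, by simp⟩
  | insert q t hq ih =>
  have hqt : ∀ p ∈ t, Disjoint (Icc p.1 p.2) (Icc q.1 q.2) := fun p hp =>
    hd (Finset.mem_coe.2 (Finset.mem_insert_of_mem hp))
      (Finset.mem_coe.2 (Finset.mem_insert_self q t)) fun h => hq (h ▸ hp)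
  have hltq : q.1 < q.2 := hlt q (Finset.mem_insert_self q t)
  have hltt : ∀ p ∈ t, p.1 < p.2 := fun p hp => hlt p (Finset.mem_insert_of_mem hp)
  have hne : ∀ p ∈ t, q.2 - p.2 ≠ 0 := by
    intro p hp h
    exact Set.disjoint_left.1 (hqt p hp) (right_mem_Icc.2 (hltt p hp).le)
      (by rw [← sub_eq_zero.1 h]; exact right_mem_Icc.2 hltq.le)
  obtain ⟨c, hc, hsum, hw⟩ := ih hltt
    (hd.subset (Finset.coe_subset.2 (Finset.subset_insert q t)))
  have hprod : 1 - ∏ p ∈ t, (q.2 - p.1) / (q.2 - p.2) = ∑ p ∈ t, c p / (p.2 - q.2) := by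
    have := hw q.2 fun p hp h => hne p hp (sub_eq_zero.2 (by exact_mod_cast h))
    exact_mod_cast this
  set l := q.2 - q.1 with hl
  let c' : ℝ × ℝ → ℝ := fun p =>
    if p = q then l * (1 - ∑ p ∈ t, c p / (p.2 - q.2)) else c p * (1 - l / (q.2 - p.2))
  have hc'q : c' q = l * (1 - ∑ p ∈ t, c p / (p.2 - q.2)) := if_pos rfl
  have hc't : ∀ p ∈ t, c' p = c p * (1 - l / (q.2 - p.2)) := fun p hp =>
    if_neg fun h : p = q => hq (h ▸ hp)
  refine ⟨c', fun p hp => ?_, ?_, fun w hw' => ?_⟩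
  · rcases Finset.mem_insert.1 hp with rfl | hp
    · rw [hc'q, ← hprod, sub_sub_cancel]
      exact mul_pos (sub_pos.2 hltq) (Finset.prod_pos fun r hr =>
        div_pos_of_disjoint_Icc (hltt r hr) (hqt r hr) (right_mem_Icc.2 hltq.le))
    · rw [hc't p hp]
      refine mul_pos (hc p hp) ?_
      have h1 := div_pos_of_disjoint_Icc hltq (hqt p hp).symm
        (right_mem_Icc.2 (hltt p hp).le)
      have h2 := hne p hp
      have h3 : p.2 - q.2 ≠ 0 := fun h => h2 (by linarith)
      have : 1 - l / (q.2 - p.2) = (p.2 - q.1) / (p.2 - q.2) := by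
        rw [hl]
        field_simp
        ring
      rwa [this]
  · rw [Finset.sum_insert hq, Finset.sum_insert hq, ← hsum, hc'q, Finset.sum_congr rfl hc't,
      mul_sub, mul_one, Finset.mul_sum, sub_add, ← Finset.sum_sub_distrib, ← hl, sub_eq_add_neg,
      ← Finset.sum_neg_distrib]
    congr 1
    refine Finset.sum_congr rfl fun p hp => ?_
    have h2 := hne p hp
    have h3 : p.2 - q.2 ≠ 0 := fun h => h2 (by linarith)
    field_simp
    ring
  · have hwq : (q.2 : ℂ) - w ≠ 0 := fun h =>
      hw' q (Finset.mem_insert_self q t) (sub_eq_zero.1 h).symm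
    have hwq' : w - (q.2 : ℂ) ≠ 0 := fun h =>
      hw' q (Finset.mem_insert_self q t) (sub_eq_zero.1 h)
    have hwt := hw w fun p hp => hw' p (Finset.mem_insert_of_mem hp)
    have hPt : ∏ p ∈ t, (w - p.1) / (w - p.2) = 1 - ∑ p ∈ t, (c p : ℂ) / (p.2 - w) := by
      rw [← hwt, sub_sub_cancel]
    have hfac : (w - q.1) / (w - q.2) = 1 - (l : ℂ) / (q.2 - w) := by
      rw [hl]
      push_cast
      field_simp
      ring
    have hterm : ∀ p ∈ t, (c' p : ℂ) / (p.2 - w) = (c p : ℂ) / (p.2 - w)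
        + ((l : ℂ) / (q.2 - w)) * ((c p : ℂ) / (p.2 - q.2))
        - ((l : ℂ) / (q.2 - w)) * ((c p : ℂ) / (p.2 - w)) := by
      intro p hp
      have h1 : (p.2 : ℂ) - w ≠ 0 := fun h =>
        hw' p (Finset.mem_insert_of_mem hp) (sub_eq_zero.1 h).symm
      have h2 : (q.2 : ℂ) - p.2 ≠ 0 := by exact_mod_cast hne p hp
      have h3 : (p.2 : ℂ) - q.2 ≠ 0 := fun h => h2 (by linear_combination -h)
      rw [hc't p hp]
      push_cast
      field_simp
      ring
    rw [Finset.prod_insert hq, Finset.sum_insert hq, Finset.sum_congr rfl hterm, hPt, hfac, hc'q,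
      Finset.sum_sub_distrib, Finset.sum_add_distrib, ← Finset.mul_sum, ← Finset.mul_sum]
    push_cast
    ring

/-- Any unimodular `c ≠ 1` is the quotient `conj p / p` for some unimodular `p` in the open upper
half-plane. -/
lemma exists_im_pos_mul_eq_conj {c : ℂ} (hc : ‖c‖ = 1) (hc1 : c ≠ 1) :
    ∃ p : ℂ, ‖p‖ = 1 ∧ 0 < p.im ∧ c * p = (starRingEnd ℂ) p := by
  obtain ⟨q, hq⟩ := IsAlgClosed.exists_pow_nat_eq ((starRingEnd ℂ) c) (n := 2) two_pos
  have hqn : ‖q‖ = 1 := by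
    have : ‖q‖ ^ 2 = 1 := by rw [← norm_pow, hq, RCLike.norm_conj, hc]
    exact (pow_eq_one_iff_of_nonneg (norm_nonneg q) two_ne_zero).1 this
  have hqq : q * (starRingEnd ℂ) q = 1 := by
    rw [Complex.mul_conj, Complex.normSq_eq_norm_sq, hqn]; simp
  have hcq : c = (starRingEnd ℂ) q ^ 2 := by
    rw [← map_pow, hq, Complex.conj_conj]
  have hcp : c * q = (starRingEnd ℂ) q := by
    rw [hcq]
    linear_combination ((starRingEnd ℂ) q) * hqq
  have him : q.im ≠ 0 := by
    intro h
    rw [Complex.conj_eq_iff_im.2 h] at hqq hcq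
    exact hc1 (by rw [hcq]; linear_combination hqq)
  rcases him.lt_or_gt with h | h
  · exact ⟨-q, by rwa [norm_neg], by simpa using h, by rw [map_neg, mul_neg, hcp]⟩
  · exact ⟨q, hqn, h, hcp⟩

/-- A Cayley transform of `lam * (1 - ∏ (x - a) / (x - b))`, with `[a, b]` ranging over disjoint
intervals, is a finite Blaschke product of the upper half-plane. -/
lemma exists_isRealLineBlaschke_of_intervals (t : Finset (ℝ × ℝ)) (hlt : ∀ p ∈ t, p.1 < p.2)
    (hd : (t : Set (ℝ × ℝ)).PairwiseDisjoint fun p => Icc p.1 p.2) {lam : ℝ} (hlam : 0 < lam)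
    {p : ℂ} (hp : 0 < p.im) {c : ℂ} (hc : ‖c‖ = 1) :
    ∃ g : ℝ → ℂ, IsRealLineBlaschke g ∧ ∀ x : ℝ, (∀ q ∈ t, x ≠ q.2) →
      g x = c * ((((lam * (1 - ∏ q ∈ t, (x - q.1) / (x - q.2)) : ℝ) : ℂ) - p) /
        (((lam * (1 - ∏ q ∈ t, (x - q.1) / (x - q.2)) : ℝ) : ℂ) - (starRingEnd ℂ) p)) := by
  classical
  obtain ⟨k, hk, -, hkw⟩ := exists_partialFractions_one_sub_prod t hlt hd
  set P : Polynomial ℂ := ∏ q ∈ t, (Polynomial.X - Polynomial.C (q.1 : ℂ)) with hP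
  set Q : Polynomial ℂ := ∏ q ∈ t, (Polynomial.X - Polynomial.C (q.2 : ℂ)) with hQ
  have hPe : ∀ w, P.eval w = ∏ q ∈ t, (w - (q.1 : ℂ)) := fun w => by
    simp [hP, Polynomial.eval_prod]
  have hQe : ∀ w, Q.eval w = ∏ q ∈ t, (w - (q.2 : ℂ)) := fun w => by
    simp [hQ, Polynomial.eval_prod]
  set N : Polynomial ℂ := Polynomial.C ((lam : ℂ) - p) * Q - Polynomial.C (lam : ℂ) * P with hN
  have hNe : ∀ w, N.eval w = ((lam : ℂ) - p) * Q.eval w - lam * P.eval w := fun w => by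
    simp [hN]
  have hQ0 : ∀ w : ℂ, (∀ q ∈ t, w ≠ (q.2 : ℂ)) → Q.eval w ≠ 0 := fun w hw => by
    rw [hQe]
    exact Finset.prod_ne_zero_iff.2 fun q hq => sub_ne_zero.2 (hw q hq)
  have hNQ : ∀ w : ℂ, (∀ q ∈ t, w ≠ (q.2 : ℂ)) → N.eval w =
      Q.eval w * (lam * (1 - ∏ q ∈ t, (w - q.1) / (w - q.2)) - p) := fun w hw => by
    have := hQ0 w hw
    rw [hNe, Finset.prod_div_distrib, ← hPe, ← hQe]
    field_simp
    ring
  have hreal : ∀ x : ℝ, (lam : ℂ) * (1 - ∏ q ∈ t, ((x : ℂ) - q.1) / (x - q.2)) =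
      ((lam * (1 - ∏ q ∈ t, (x - q.1) / (x - q.2)) : ℝ) : ℂ) := fun x => by push_cast; rfl
  have hN0 : N ≠ 0 := by
    intro h
    obtain ⟨x, hx⟩ := Infinite.exists_notMem_finset (t.image Prod.snd)
    have hx' : ∀ q ∈ t, (x : ℂ) ≠ (q.2 : ℂ) := fun q hq h =>
      hx (Finset.mem_image.2 ⟨q, hq, by exact_mod_cast h.symm⟩)
    have h1 := hNQ x hx'
    rw [h, Polynomial.eval_zero, hreal] at h1
    exact mul_ne_zero (hQ0 x hx') (ofReal_sub_ne_zero_of_im_pos hp _) h1.symm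
  have hroots : ∀ w, N.eval w = 0 → 0 < w.im := by
    intro w hw
    by_cases hb : ∀ q ∈ t, w ≠ (q.2 : ℂ)
    · rw [hNQ w hb, hkw w hb] at hw
      have h1 : (lam : ℂ) * ∑ q ∈ t, (k q : ℂ) / (q.2 - w) = p :=
        sub_eq_zero.1 ((mul_eq_zero.1 hw).resolve_left (hQ0 w hb))
      have h2 := congrArg Complex.im h1
      have h3 : ∀ q ∈ t, ((k q : ℂ) / (q.2 - w)).im =
          w.im * (k q / Complex.normSq (q.2 - w)) := fun q _ => by
        rw [Complex.div_im]
        simp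
        ring
      rw [Complex.im_ofReal_mul, Complex.im_sum, Finset.sum_congr rfl h3, ← Finset.mul_sum] at h2
      have h4 : 0 ≤ ∑ q ∈ t, k q / Complex.normSq (q.2 - w) :=
        Finset.sum_nonneg fun q hq => div_nonneg (hk q hq).le (Complex.normSq_nonneg _)
      by_contra! h5
      have := mul_nonpos_of_nonneg_of_nonpos hlam.le (mul_nonpos_of_nonpos_of_nonneg h5 h4)
      linarith
    · push Not at hb
      obtain ⟨q, hq, rfl⟩ := hb
      exfalso
      have hQz : Q.eval (q.2 : ℂ) = 0 := by
        rw [hQe]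
        exact Finset.prod_eq_zero hq (sub_self _)
      rw [hNe, hQz, mul_zero, zero_sub, neg_eq_zero, mul_eq_zero, hPe,
        Finset.prod_eq_zero_iff] at hw
      rcases hw with h | ⟨r, hr, h⟩
      · exact hlam.ne' (by exact_mod_cast h)
      · have hqr : q.2 = r.1 := by exact_mod_cast sub_eq_zero.1 h
        by_cases hrq : r = q
        · subst hrq
          exact (hlt r hr).ne' hqr
        · exact Set.disjoint_left.1 (hd (Finset.mem_coe.2 hr) (Finset.mem_coe.2 hq) hrq)
            (left_mem_Icc.2 (hlt r hr).le) (hqr ▸ right_mem_Icc.2 (hlt q hq).le)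
  refine ⟨_, isRealLineBlaschke_polynomial hN0 hroots hc, fun x hx => ?_⟩
  have hx' : ∀ q ∈ t, (x : ℂ) ≠ (q.2 : ℂ) := fun q hq h => hx q hq (by exact_mod_cast h)
  have hQc : (starRingEnd ℂ) (Q.eval (x : ℂ)) = Q.eval (x : ℂ) := by
    rw [hQe, map_prod]
    simp
  simp only [hNQ x hx', hreal, map_mul, map_sub, hQc, Complex.conj_ofReal]
  rw [mul_div_mul_left _ _ (hQ0 x hx')]

lemma exists_isRealLineBlaschke_near_const_near_one {A B : Set ℝ} (hA : IsCompact A)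
    (hB : IsClosed B) (hAB : Disjoint A B) (hA0 : volume A = 0) {c : ℂ} (hc : ‖c‖ = 1) {ε : ℝ}
    (hε : 0 < ε) :
    ∃ g : ℝ → ℂ, IsRealLineBlaschke g ∧ (∀ x ∈ A, ‖g x - c‖ < ε) ∧ ∀ x ∈ B, ‖g x - 1‖ < ε := by
  by_cases hc1 : c = 1
  · exact ⟨_, isRealLineBlaschke_const hc, fun x _ => by simpa using hε,
      fun x _ => by simpa [hc1] using hε⟩
  obtain ⟨p, hpn, hp, hcp⟩ := exists_im_pos_mul_eq_conj hc hc1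
  have hpc : ‖(starRingEnd ℂ) p‖ = 1 := by rw [RCLike.norm_conj, hpn]
  have hpp : ‖(starRingEnd ℂ) p - p‖ ≤ 2 := (norm_sub_le _ _).trans (by rw [hpc, hpn]; norm_num)
  obtain ⟨d, hd, hdAB⟩ := hAB.exists_thickenings hA hB
  set lam : ℝ := 1 + 4 / ε with hlam_def
  have hlam : 0 < lam := by positivity
  set η : ℝ := min (1 / 2) (ε / 8) with hη_def
  have hη : 0 < η := by positivity
  set δ : ℝ := d * η / lam with hδ_def
  have hδ : 0 < δ := by positivity
  obtain ⟨V, hAV, hVo, hVδ⟩ := A.exists_isOpen_lt_of_lt (ENNReal.ofReal δ)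
    (by rw [hA0]; exact ENNReal.ofReal_pos.2 hδ)
  obtain ⟨t, hlt, htV, hAt, hdisj⟩ := hA.exists_pairwiseDisjoint_Icc_cover
    (hVo.inter (isOpen_thickening (δ := d) (E := A)))
    (subset_inter hAV (self_subset_thickening hd A))
  obtain ⟨g, hg, hgx⟩ := exists_isRealLineBlaschke_of_intervals t hlt hdisj hlam hp hc
  have hsum : ∑ q ∈ t, (q.2 - q.1) ≤ δ := by
    have h1 : volume (⋃ q ∈ t, Icc q.1 q.2) = ∑ q ∈ t, volume (Icc q.1 q.2) :=
      measure_biUnion_finset hdisj fun _ _ => measurableSet_Icc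
    have h2 : volume (⋃ q ∈ t, Icc q.1 q.2) ≤ ENNReal.ofReal δ :=
      (measure_mono (iUnion₂_subset fun q hq => (htV q hq).trans inter_subset_left)).trans hVδ.le
    simp only [h1, Real.volume_Icc] at h2
    rw [← ENNReal.ofReal_sum_of_nonneg fun q hq => (sub_pos.2 (hlt q hq)).le] at h2
    exact (ENNReal.ofReal_le_ofReal_iff hδ.le).1 h2
  refine ⟨g, hg, fun x hx => ?_, fun x hx => ?_⟩
  · obtain ⟨r, hr, hxr⟩ := mem_iUnion₂.1 (hAt hx)
    have hxq : ∀ q ∈ t, q ≠ r → Disjoint (Icc q.1 q.2) (Icc r.1 r.2) := fun q hq hqr =>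
      hdisj (Finset.mem_coe.2 hq) (Finset.mem_coe.2 hr) hqr
    have hxne : ∀ q ∈ t, x ≠ q.2 := by
      rintro q hq rfl
      by_cases hqr : q = r
      · subst hqr
        exact lt_irrefl _ hxr.2
      · exact Set.disjoint_left.1 (hxq q hq hqr) (right_mem_Icc.2 (hlt q hq).le)
          (Ioo_subset_Icc_self hxr)
    have hprod : ∏ q ∈ t, (x - q.1) / (x - q.2) < 0 := by
      classical
      rw [← Finset.mul_prod_erase t _ hr]
      refine mul_neg_of_neg_of_pos (div_neg_of_pos_of_neg (sub_pos.2 hxr.1) (sub_neg.2 hxr.2))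
        (Finset.prod_pos fun q hq => ?_)
      exact div_pos_of_disjoint_Icc (hlt q (Finset.mem_of_mem_erase hq))
        (hxq q (Finset.mem_of_mem_erase hq) (Finset.ne_of_mem_erase hq)) (Ioo_subset_Icc_self hxr)
    rw [hgx x hxne]
    set f : ℝ := lam * (1 - ∏ q ∈ t, (x - q.1) / (x - q.2)) with hf
    have hfl : lam ≤ f := by
      rw [hf]
      nlinarith
    have hnorm : 4 / ε ≤ ‖(f : ℂ) - (starRingEnd ℂ) p‖ := by
      have h1 := norm_sub_norm_le (f : ℂ) ((starRingEnd ℂ) p)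
      rw [hpc, Complex.norm_real, Real.norm_eq_abs] at h1
      have h2 := le_abs_self f
      linarith
    have hpos : 0 < 4 / ε := by positivity
    have hne : (f : ℂ) - (starRingEnd ℂ) p ≠ 0 := norm_pos_iff.1 (hpos.trans_le hnorm)
    have : c * (((f : ℂ) - p) / (f - (starRingEnd ℂ) p)) - c =
        c * (((starRingEnd ℂ) p - p) / (f - (starRingEnd ℂ) p)) := by
      field_simp
      ring
    rw [this, norm_mul, hc, one_mul, norm_div]
    calc _ ≤ 2 / (4 / ε) := div_le_div₀ zero_le_two hpp hpos hnorm
      _ = ε / 2 := by field_simp; norm_num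
      _ < ε := half_lt_self hε
  · have hdist : ∀ q ∈ t, d ≤ |q.2 - x| := by
      intro q hq
      by_contra! h
      have h1 : q.2 ∈ thickening d A := (htV q hq (right_mem_Icc.2 (hlt q hq).le)).2
      have h2 : q.2 ∈ thickening d B := mem_thickening_iff.2 ⟨x, hx, by rwa [Real.dist_eq]⟩
      exact Set.disjoint_left.1 hdAB h1 h2
    have hxne : ∀ q ∈ t, x ≠ q.2 := by
      rintro q hq rfl
      have := hdist q hq
      rw [sub_self, abs_zero] at this
      linarith
    obtain ⟨k, hk, hks, hkw⟩ := exists_partialFractions_one_sub_prod t hlt hdisj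
    have hfrac : 1 - ∏ q ∈ t, (x - q.1) / (x - q.2) = ∑ q ∈ t, k q / (q.2 - x) := by
      have := hkw x fun q hq h => hxne q hq (by exact_mod_cast h)
      exact_mod_cast this
    rw [hgx x hxne]
    set f : ℝ := lam * (1 - ∏ q ∈ t, (x - q.1) / (x - q.2)) with hf
    have hfη : |f| ≤ η := by
      rw [hf, hfrac, abs_mul, abs_of_pos hlam]
      have h1 : |∑ q ∈ t, k q / (q.2 - x)| ≤ δ / d :=
        calc _ ≤ ∑ q ∈ t, |k q / (q.2 - x)| := Finset.abs_sum_le_sum_abs _ _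
          _ ≤ ∑ q ∈ t, k q / d := Finset.sum_le_sum fun q hq => by
            rw [abs_div, abs_of_pos (hk q hq)]
            exact div_le_div_of_nonneg_left (hk q hq).le hd (hdist q hq)
          _ ≤ δ / d := by
            rw [← Finset.sum_div, hks]
            gcongr
      calc _ ≤ lam * (δ / d) := by gcongr
        _ = η := by rw [hδ_def]; field_simp
    have hη1 : η ≤ 1 / 2 := min_le_left _ _
    have hη2 : η ≤ ε / 8 := min_le_right _ _
    have hnorm : 1 / 2 ≤ ‖(f : ℂ) - (starRingEnd ℂ) p‖ := by
      have h1 := norm_sub_norm_le ((starRingEnd ℂ) p) (f : ℂ)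
      rw [hpc, Complex.norm_real, Real.norm_eq_abs, norm_sub_rev] at h1
      linarith
    have hne : (f : ℂ) - (starRingEnd ℂ) p ≠ 0 :=
      norm_pos_iff.1 (lt_of_lt_of_le (by norm_num) hnorm)
    have : c * (((f : ℂ) - p) / (f - (starRingEnd ℂ) p)) - 1 =
        f * (c - 1) / (f - (starRingEnd ℂ) p) := by
      field_simp
      linear_combination -hcp
    have hc2 : ‖c - 1‖ ≤ 2 := (norm_sub_le _ _).trans (by rw [hc, norm_one]; norm_num)
    rw [this, norm_div, norm_mul, Complex.norm_real, Real.norm_eq_abs]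
    calc _ ≤ (η * 2) / (1 / 2) := by gcongr
      _ < ε := by linarith

/-- Every continuous map from a null compact set of reals to the circle is a uniform limit of
finite Blaschke products of the upper half-plane. -/
lemma isBlaschkeApproximable_of_continuous {K : Set ℝ} (hK : IsCompact K) (hK0 : volume K = 0)
    {ψ : K → Circle} (hψ : Continuous ψ) : IsBlaschkeApproximable ψ := by
  have : CompactSpace K := isCompact_iff_compactSpace.1 hK
  have : TotallyDisconnectedSpace K := by
    rw [totallyDisconnectedSpace_subtype_iff, isTotallyDisconnected_iff_lt]
    intro x _ y _ hxy
    by_contra! h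
    have h1 : Ioo x y ⊆ K := fun z hz => by
      by_contra hzK
      exact h z hzK hz
    have h2 := measure_mono_null h1 hK0
    rw [Real.volume_Ioo, ENNReal.ofReal_eq_zero] at h2
    linarith
  intro ε hε
  obtain ⟨n, U, v, hUv⟩ :=
    ContinuousMap.exists_finite_sum_const_mulIndicator_approximation_of_mem_nhds_diagonal
      (S := {q : Circle × Circle | dist q.1 q.2 < ε / 2}) ⟨ψ, hψ⟩ (by
        rw [mem_nhdsSet_iff_forall]
        rintro ⟨a, b⟩ (rfl : a = b)
        exact (isOpen_lt (by fun_prop) continuous_const).mem_nhds (by simpa using hε))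
  have key : IsBlaschkeApproximable
      (∏ i, (U i : Set K).mulIndicator fun _ => v i) := by
    refine IsBlaschkeApproximable.prod _ fun i _ η hη => ?_
    have hU : IsCompact ((↑) '' (U i : Set K) : Set ℝ) :=
      (U i).isClopen.isClosed.isCompact.image continuous_subtype_val
    have hUc : IsCompact ((↑) '' (U i : Set K)ᶜ : Set ℝ) :=
      (U i).isClopen.compl.isClosed.isCompact.image continuous_subtype_val
    obtain ⟨g, hg, hgA, hgB⟩ := exists_isRealLineBlaschke_near_const_near_one hU hUc.isClosed
      ((Set.disjoint_image_iff Subtype.val_injective).2 disjoint_compl_right)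
      (measure_mono_null (Subtype.coe_image_subset K _) hK0) (Circle.norm_coe (v i)) hη
    refine ⟨g, hg, fun x => ?_⟩
    by_cases hx : x ∈ (U i : Set K)
    · rw [Set.mulIndicator_of_mem hx]
      exact hgA x ⟨x, hx, rfl⟩
    · rw [Set.mulIndicator_of_notMem hx]
      exact hgB x ⟨x, hx, rfl⟩
  obtain ⟨g, hg, hgx⟩ := key (ε / 2) (half_pos hε)
  refine ⟨g, hg, fun x => ?_⟩
  have h1 := hgx x
  rw [Finset.prod_apply] at h1
  have h2 : ‖((∏ i, (U i : Set K).mulIndicator (fun _ => v i) x : Circle) : ℂ) - ψ x‖ < ε / 2 := by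
    rw [← dist_eq_norm, dist_comm]
    exact hUv x
  calc _ ≤ _ := norm_sub_le_norm_sub_add_norm_sub _ _ _
    _ < ε / 2 + ε / 2 := add_lt_add h1 h2
    _ = ε := add_halves ε

lemma isFiniteBlaschke_id : IsFiniteBlaschke fun z => z :=
  ⟨0, 1, fun _ => 0, by simp, by simp, by simp⟩

lemma IsFiniteBlaschke.const_mul {B : ℂ → ℂ} (hB : IsFiniteBlaschke B) {c : ℂ} (hc : ‖c‖ = 1) :
    IsFiniteBlaschke fun z => c * B z := by
  obtain ⟨n, ζ, w, hζ, hw, h⟩ := hB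
  exact ⟨n, c * ζ, w, by simp [hc, hζ], hw, fun z => by simp only [h, mul_assoc]⟩

lemma IsFiniteBlaschke.mul_discAutomorphism {B : ℂ → ℂ} (hB : IsFiniteBlaschke B) {v : ℂ}
    (hv : ‖v‖ < 1) :
    IsFiniteBlaschke fun z => (z - v) / (1 - (starRingEnd ℂ) v * z) * B z := by
  obtain ⟨n, ζ, w, hζ, hw, h⟩ := hB
  refine ⟨n + 1, ζ, Fin.cons v w, hζ, fun k => ?_, fun z => ?_⟩
  · refine Fin.cases ?_ (fun k => ?_) k
    · simpa using hv
    · simpa using hw k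
  · simp only [h, Fin.prod_univ_succ, Fin.cons_zero, Fin.cons_succ]
    ring

/-- The real parameter of the point `z` of the unit circle under the Cayley transform
`z ↦ I * (ξ + z) / (ξ - z)`. -/
def circleToLine (ξ z : ℂ) : ℝ := (I * (ξ + z) / (ξ - z)).re

lemma coe_circleToLine {ξ z : ℂ} (hξ : ‖ξ‖ = 1) (hz : ‖z‖ = 1) :
    (circleToLine ξ z : ℂ) = I * (ξ + z) / (ξ - z) := by
  refine Complex.conj_eq_iff_re.1 ?_
  have hξ0 : ξ ≠ 0 := norm_ne_zero_iff.1 (by rw [hξ]; exact one_ne_zero)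
  have hz0 : z ≠ 0 := norm_ne_zero_iff.1 (by rw [hz]; exact one_ne_zero)
  rw [map_div₀, map_mul, map_add, map_sub, Complex.conj_I, ← Complex.inv_eq_conj hξ,
    ← Complex.inv_eq_conj hz]
  by_cases h : ξ = z
  · simp [h]
  have h1 : ξ - z ≠ 0 := sub_ne_zero.2 h
  have h2 : ξ⁻¹ - z⁻¹ ≠ 0 := sub_ne_zero.2 fun h' => h (inv_injective h')
  rw [div_eq_div_iff h2 h1]
  field_simp
  ring

lemma eq_of_coe_circleToLine {ξ z : ℂ} (hξ : ‖ξ‖ = 1) (hz : ‖z‖ = 1) (h : z ≠ ξ) :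
    ξ * ((circleToLine ξ z - I) / (circleToLine ξ z + I)) = z := by
  have hξ0 : ξ ≠ 0 := norm_ne_zero_iff.1 (by rw [hξ]; exact one_ne_zero)
  have h1 : ξ - z ≠ 0 := sub_ne_zero.2 h.symm
  have e1 : I * (ξ + z) / (ξ - z) - I = 2 * I * z / (ξ - z) := by
    field_simp
    ring
  have e2 : I * (ξ + z) / (ξ - z) + I = 2 * I * ξ / (ξ - z) := by
    field_simp
    ring
  have hI := Complex.I_ne_zero
  rw [coe_circleToLine hξ hz, e1, e2]
  field_simp

/-- The Cayley transform carries a half-plane Blaschke factor to a disc one. -/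
lemma exists_discAutomorphism_eq {ξ ω : ℂ} (hξ : ‖ξ‖ = 1) (hω : 0 < ω.im) :
    ∃ c v : ℂ, ‖c‖ = 1 ∧ ‖v‖ < 1 ∧ ∀ z : ℂ, ‖z‖ = 1 → z ≠ ξ →
      ((circleToLine ξ z : ℂ) - ω) / (starRingEnd ℂ) ((circleToLine ξ z : ℂ) - ω) =
        c * ((z - v) / (1 - (starRingEnd ℂ) v * z)) := by
  have hξ0 : ξ ≠ 0 := norm_ne_zero_iff.1 (by rw [hξ]; exact one_ne_zero)
  have hωI : ω + I ≠ 0 := fun h => by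
    have := congrArg Complex.im h
    simp at this
    linarith
  have hωI' : (starRingEnd ℂ) ω - I ≠ 0 := by
    have : (starRingEnd ℂ) (ω + I) ≠ 0 := (map_ne_zero _).2 hωI
    simpa [sub_eq_add_neg] using this
  refine ⟨-(ω + I) / (ξ * ((starRingEnd ℂ) ω - I)), ξ * ((ω - I) / (ω + I)), ?_, ?_,
    fun z hz hzξ => ?_⟩
  · have : (starRingEnd ℂ) ω - I = (starRingEnd ℂ) (ω + I) := by simp [sub_eq_add_neg]
    rw [this, norm_div, norm_mul, norm_neg, RCLike.norm_conj, hξ, one_mul, div_self]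
    exact norm_ne_zero_iff.2 hωI
  · rw [norm_mul, hξ, one_mul, norm_div, div_lt_one (norm_pos_iff.2 hωI)]
    refine lt_of_pow_lt_pow_left₀ 2 (norm_nonneg _) ?_
    rw [← Complex.normSq_eq_norm_sq, ← Complex.normSq_eq_norm_sq, Complex.normSq_apply,
      Complex.normSq_apply]
    simp
    nlinarith
  · have h1 : ξ - z ≠ 0 := sub_ne_zero.2 hzξ.symm
    have hx := coe_circleToLine hξ hz
    have hd1 : (circleToLine ξ z : ℂ) - (starRingEnd ℂ) ω ≠ 0 := by
      have := (map_ne_zero (starRingEnd ℂ)).2 (ofReal_sub_ne_zero_of_im_pos hω (circleToLine ξ z))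
      simpa using this
    rw [map_sub, Complex.conj_ofReal]
    rw [hx] at hd1 ⊢
    have e1 : I * (ξ + z) / (ξ - z) - ω =
        (ω + I) * (z - ξ * ((ω - I) / (ω + I))) / (ξ - z) := by
      field_simp
      ring
    have e2 : I * (ξ + z) / (ξ - z) - (starRingEnd ℂ) ω =
        -(ξ * ((starRingEnd ℂ) ω - I)) *
          (1 - (starRingEnd ℂ) (ξ * ((ω - I) / (ω + I))) * z) / (ξ - z) := by
      rw [map_mul, map_div₀, map_sub, map_add, Complex.conj_I, ← Complex.inv_eq_conj hξ,
        ← sub_eq_add_neg]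
      field_simp
      ring
    have h2 : 1 - (starRingEnd ℂ) (ξ * ((ω - I) / (ω + I))) * z ≠ 0 := by
      intro h
      rw [e2, h] at hd1
      simp at hd1
    rw [e1, e2, div_div_div_cancel_right₀ h1, neg_mul, div_neg, neg_div, neg_mul,
      mul_div_mul_comm]

/-- Up to a factor `z`, a half-plane Blaschke product transfers to the circle as a finite Blaschke
product. -/
lemma IsRealLineBlaschke.exists_isFiniteBlaschke {g : ℝ → ℂ} (hg : IsRealLineBlaschke g) {ξ : ℂ}
    (hξ : ‖ξ‖ = 1) :
    ∃ B, IsFiniteBlaschke B ∧ ∀ z : ℂ, ‖z‖ = 1 → z ≠ ξ → B z = g (circleToLine ξ z) * z := by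
  obtain ⟨ζ, s, hζ, hs, h⟩ := hg
  simp only [h]
  clear h
  induction s using Multiset.induction_on with
  | empty => exact ⟨_, isFiniteBlaschke_id.const_mul hζ, fun z _ _ => by simp⟩
  | cons ω s ih =>
    obtain ⟨B, hB, hBz⟩ := ih fun ω hω => hs ω (Multiset.mem_cons_of_mem hω)
    obtain ⟨c, v, hc, hv, hcv⟩ :=
      exists_discAutomorphism_eq hξ (hs ω (Multiset.mem_cons_self ω s))
    refine ⟨_, (hB.mul_discAutomorphism hv).const_mul hc, fun z hz hzξ => ?_⟩
    rw [Multiset.map_cons, Multiset.prod_cons, hcv z hz hzξ, hBz z hz hzξ]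
    ring

lemma volume_circleMap_preimage_eq_zero {K : Set ℂ} (hK : MeasurableSet K)
    (hK0 : arclength K = 0) :
    volume (circleMap 0 1 ⁻¹' K ∩ Ioc 0 (2 * Real.pi)) = 0 := by
  have hm : Measurable (circleMap 0 1) := (continuous_circleMap 0 1).measurable
  rwa [arclength, Measure.map_apply hm hK, Measure.restrict_apply (hm hK)] at hK0

lemma volume_image_circleToLine_eq_zero {K : Set ℂ} (hK : MeasurableSet K)
    (hKs : K ⊆ Metric.sphere (0 : ℂ) 1) (hK0 : arclength K = 0) {ξ : ℂ} (hξ : ξ ∉ K) :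
    volume (circleToLine ξ '' K) = 0 := by
  have hsub : circleToLine ξ '' K ⊆
      (fun θ => circleToLine ξ (circleMap 0 1 θ)) ''
        (circleMap 0 1 ⁻¹' K ∩ Ioc 0 (2 * Real.pi)) := by
    rintro _ ⟨z, hz, rfl⟩
    have hzs : z ∈ circleMap 0 1 '' Ioc 0 (2 * Real.pi) := by
      rw [image_circleMap_Ioc, abs_one]
      exact hKs hz
    obtain ⟨θ, hθ, rfl⟩ := hzs
    exact ⟨θ, ⟨hz, hθ⟩, rfl⟩
  refine measure_mono_null hsub
    (addHaar_image_eq_zero_of_differentiableOn_of_addHaar_eq_zero volume ?_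
      (volume_circleMap_preimage_eq_zero hK hK0))
  intro θ hθ
  have h1 : ξ - circleMap 0 1 θ ≠ 0 := fun h => hξ (by rw [sub_eq_zero.1 h]; exact hθ.1)
  have h2 : DifferentiableAt ℝ (circleMap 0 1) θ := differentiable_circleMap 0 1 θ
  have h3 : DifferentiableAt ℝ
      (fun θ => I * (ξ + circleMap 0 1 θ) / (ξ - circleMap 0 1 θ)) θ :=
    ((h2.const_add ξ).const_mul I).div (h2.const_sub ξ) h1
  exact (Complex.reCLM.differentiableAt.comp θ h3).differentiableWithinAt

lemma continuousOn_circleToLine {K : Set ℂ} {ξ : ℂ} (hξ : ξ ∉ K) :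
    ContinuousOn (circleToLine ξ) K := by
  refine Complex.continuous_re.comp_continuousOn (ContinuousOn.div (by fun_prop) (by fun_prop) ?_)
  exact fun z hz h => hξ (by rwa [sub_eq_zero.1 h])

lemma exists_norm_eq_one_notMem {K : Set ℂ} (hK : MeasurableSet K) (hK0 : arclength K = 0) :
    ∃ ξ : ℂ, ‖ξ‖ = 1 ∧ ξ ∉ K := by
  by_contra! h
  have h1 := volume_circleMap_preimage_eq_zero hK hK0
  have h2 : circleMap 0 1 ⁻¹' K = univ :=
    eq_univ_of_forall fun θ => h _ (by simp)
  rw [h2, univ_inter, Real.volume_Ioc, ENNReal.ofReal_eq_zero] at h1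
  linarith [Real.pi_pos]

/-- Fisher's theorem: unimodular continuous functions on a compact subset of the circle of
arclength measure 0 can be uniformly approximated by finite Blaschke products. -/
theorem fisher_approx (K : Set ℂ) (hKc : IsCompact K) (hKs : K ⊆ Metric.sphere (0:ℂ) 1)
    (hK0 : arclength K = 0)
    (φ : ℂ → ℂ) (hφc : ContinuousOn φ K) (hφ1 : ∀ z ∈ K, ‖φ z‖ = 1)
    (ε : ℝ) (hε : 0 < ε) :
    ∃ B : ℂ → ℂ, IsFiniteBlaschke B ∧ ∀ z ∈ K, ‖B z - φ z‖ < ε := by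
  obtain ⟨ξ, hξ, hξK⟩ := exists_norm_eq_one_notMem hKc.measurableSet hK0
  have hnorm : ∀ z ∈ K, ‖z‖ = 1 := fun z hz => by simpa using hKs hz
  have hne : ∀ z ∈ K, z ≠ ξ := fun z hz h => hξK (h ▸ hz)
  let F : ℝ → ℂ := fun x => ξ * (((x : ℂ) - I) / (x + I))
  have hF : Continuous F := by
    refine continuous_const.mul (Continuous.div (by fun_prop) (by fun_prop) fun x h => ?_)
    have := congrArg Complex.im h
    simp at this
  have hFz : ∀ z ∈ K, F (circleToLine ξ z) = z := fun z hz =>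
    eq_of_coe_circleToLine hξ (hnorm z hz) (hne z hz)
  have hFK : ∀ x : circleToLine ξ '' K, F x ∈ K := by
    rintro ⟨_, z, hz, rfl⟩
    rwa [hFz z hz]
  let ψ : circleToLine ξ '' K → Circle := fun x =>
    ⟨φ (F x) / F x, by
      rw [← SetLike.mem_coe, Submonoid.coe_unitSphere, mem_sphere_zero_iff_norm, norm_div,
        hφ1 _ (hFK x), hnorm _ (hFK x), div_one]⟩
  have hψ : Continuous ψ := by
    have hFc : Continuous fun x : circleToLine ξ '' K => F x := hF.comp continuous_subtype_val
    refine Continuous.subtype_mk ((hφc.comp_continuous hFc hFK).div hFc fun x => ?_) _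
    exact norm_ne_zero_iff.1 (by rw [hnorm _ (hFK x)]; exact one_ne_zero)
  obtain ⟨g, hg, hgψ⟩ := isBlaschkeApproximable_of_continuous
    (hKc.image_of_continuousOn (continuousOn_circleToLine hξK))
    (volume_image_circleToLine_eq_zero hKc.measurableSet hKs hK0 hξK) hψ ε hε
  obtain ⟨B, hB, hBz⟩ := hg.exists_isFiniteBlaschke hξ
  refine ⟨B, hB, fun z hz => ?_⟩
  have h1 := hgψ ⟨circleToLine ξ z, z, hz, rfl⟩
  have h2 : (ψ ⟨circleToLine ξ z, z, hz, rfl⟩ : ℂ) = φ z / z := by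
    change φ (F (circleToLine ξ z)) / F (circleToLine ξ z) = φ z / z
    rw [hFz z hz]
  have hz0 : z ≠ 0 := norm_ne_zero_iff.1 (by rw [hnorm z hz]; exact one_ne_zero)
  rw [h2] at h1
  have h3 : B z - φ z = (g (circleToLine ξ z) - φ z / z) * z := by
    rw [hBz z (hnorm z hz) (hne z hz)]
    field_simp
  rwa [h3, norm_mul, hnorm z hz, mul_one]
end
end

section
/- Let K be a compact subset of the unit circle of arclength measure 0, let φ : K → ℂ be continuous with |φ| ≡ 1 on K, and let T ⊆ ℂ be homeomorphic to the closed unit disc with φ(K) ⊆ T. Then there exists f continuous on the closed unit disc, holomorphic on the open disc, such that f = φ on K and f maps the closed disc into T. -/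
open Complex Metric MeasureTheory Filter Set

noncomputable section

/-- A continuous nowhere vanishing function on a simply connected space has a logarithm. -/
lemma exists_continuous_log {A : Type*} [TopologicalSpace A] [SimplyConnectedSpace A]
    [LocallyPathConnectedSpace A] {f : A → ℂ} (hf : Continuous f) (h0 : ∀ a, f a ≠ 0) :
    ∃ F : A → ℂ, Continuous F ∧ ∀ a, exp (F a) = f a := by
  obtain ⟨a₀⟩ : Nonempty A := inferInstance
  obtain ⟨F, ⟨-, hF⟩, -⟩ := isCoveringMapOn_exp.existsUnique_continuousMap_lifts
    (⟨f, hf⟩ : C(A, ℂ)) (a₀ := a₀) (e₀ := log (f a₀)) (exp_log (h0 a₀)) h0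
  exact ⟨F, F.continuous, fun a => congrFun hF a⟩

lemma eq_of_exp_eq_of_continuous {X : Type*} [TopologicalSpace X] [PreconnectedSpace X]
    {d : X → ℂ} (hd : Continuous d) (h : ∀ x y, exp (d x) = exp (d y)) (x y : X) :
    d x = d y :=
  isCoveringMap_exp.const_of_comp hd (fun z w => Subtype.ext (h z w)) x y

/-- The radial retraction of the plane onto the closed unit disc. -/
def discRetraction (z : ℂ) : ℂ := ((max 1 ‖z‖)⁻¹ : ℝ) * z

lemma continuous_discRetraction : Continuous discRetraction := by
  unfold discRetraction
  have : ∀ z : ℂ, max 1 ‖z‖ ≠ 0 := fun z => by positivity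
  fun_prop (disch := assumption)

lemma norm_discRetraction_le (z : ℂ) : ‖discRetraction z‖ ≤ 1 := by
  unfold discRetraction
  rw [norm_mul, norm_real, Real.norm_of_nonneg (by positivity), inv_mul_le_one₀ (by positivity)]
  exact le_max_right _ _

lemma discRetraction_of_norm_le {z : ℂ} (hz : ‖z‖ ≤ 1) : discRetraction z = z := by
  simp [discRetraction, max_eq_left hz]

/-- If `h` is injective on the closed unit disc, then `h - h 0` has no continuous logarithm on the
unit circle. -/
lemma no_continuous_log_of_injOn {h : ℂ → ℂ} (hc : Continuous h)
    (hi : InjOn h (closedBall 0 1)) {g : ℂ → ℂ} (hg : ContinuousOn g (sphere 0 1))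
    (hgh : ∀ z ∈ sphere (0 : ℂ) 1, exp (g z) = h z - h 0) : False := by
  let s : ℝ → ℝ := fun t => max 0 (min t 1)
  have hs0 : ∀ t, 0 ≤ s t := fun t => le_max_left _ _
  have hs1 : ∀ t, s t ≤ 1 := fun t => max_le zero_le_one (min_le_right _ _)
  have hs : Continuous s := by fun_prop
  let u : ℝ → ℂ := fun θ => exp (θ * I)
  have hu : Continuous u := by fun_prop
  have hu1 : ∀ θ, ‖u θ‖ = 1 := fun θ => norm_exp_ofReal_mul_I θ
  have hu0 : ∀ θ, u θ ≠ 0 := fun θ => exp_ne_zero _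
  let F : ℝ × ℝ → ℂ := fun p =>
    h (((1 - s p.2 / 2 : ℝ) : ℂ) * u p.1) - h (((-(s p.2 / 2) : ℝ) : ℂ) * u p.1)
  have hF : Continuous F := by fun_prop
  have hmem : ∀ (x θ : ℝ), |x| ≤ 1 → (x : ℂ) * u θ ∈ closedBall (0 : ℂ) 1 := fun x θ hx => by
    simpa [hu1] using hx
  have hF0 : ∀ p, F p ≠ 0 := by
    rintro ⟨θ, t⟩ h0
    have h1 := hs0 t
    have h2 := hs1 t
    have := hi (hmem _ _ (abs_le.2 ⟨by linarith, by linarith⟩))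
      (hmem _ _ (abs_le.2 ⟨by linarith, by linarith⟩)) (sub_eq_zero.1 h0)
    have := mul_right_cancel₀ (hu0 θ) this
    norm_cast at this
    simp only at this
    linarith
  obtain ⟨G, hG, hGF⟩ := exists_continuous_log hF hF0
  have hper : ∀ θ : ℝ, u (θ + 2 * Real.pi) = u θ := fun θ => by
    simp [u, add_mul, Complex.exp_add, exp_two_pi_mul_I]
  have hanti : ∀ θ : ℝ, u (θ + Real.pi) = -u θ := fun θ => by
    simp [u, add_mul, Complex.exp_add, exp_pi_mul_I]
  have hshift : ∀ p q : ℝ × ℝ, G (p.1 + 2 * Real.pi, p.2) - G p = G (q.1 + 2 * Real.pi, q.2) - G q :=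
    eq_of_exp_eq_of_continuous (by fun_prop) fun p q => by
      have : ∀ p : ℝ × ℝ, exp (G (p.1 + 2 * Real.pi, p.2) - G p) = 1 := fun p => by
        rw [Complex.exp_sub, hGF, hGF]
        simp only [F, hper]
        exact div_self (hF0 p)
      rw [this, this]
  have hbase : G (0 + 2 * Real.pi, 0) - G (0, 0) = 0 := by
    have hgu : Continuous fun θ => g (u θ) :=
      hg.comp_continuous hu fun θ => by simp [hu1]
    have hcst := eq_of_exp_eq_of_continuous (d := fun θ => G (θ, 0) - g (u θ))
      ((hG.comp (Continuous.prodMk_left 0)).sub hgu)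
      (fun x y => by
        have : ∀ θ, exp (G (θ, 0) - g (u θ)) = 1 := fun θ => by
          rw [Complex.exp_sub, hGF, hgh _ (by simp [hu1])]
          have hF' := hF0 (θ, 0)
          simp only [F, s] at hF' ⊢
          simp only [zero_le_one, inf_of_le_left, max_self, zero_div, sub_zero, ofReal_one, one_mul,
            neg_zero, ofReal_zero, zero_mul] at hF' ⊢
          exact div_self hF'
        rw [this, this]) (0 + 2 * Real.pi) 0
    simp only [hper] at hcst
    linear_combination hcst
  have hhalf : ∀ θ, exp (G (θ + Real.pi, 1) - G (θ, 1)) = -1 := fun θ => by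
    rw [Complex.exp_sub, hGF, hGF, div_eq_iff (hF0 _)]
    have hs1 : s 1 = 1 := by simp [s]
    simp only [F, hanti, hs1]
    rw [show ((1 - 1 / 2 : ℝ) : ℂ) * -u θ = ((-(1 / 2) : ℝ) : ℂ) * u θ by push_cast; ring,
      show ((-(1 / 2) : ℝ) : ℂ) * -u θ = ((1 - 1 / 2 : ℝ) : ℂ) * u θ by push_cast; ring]
    ring
  have hhalfc := eq_of_exp_eq_of_continuous (d := fun θ => G (θ + Real.pi, 1) - G (θ, 1))
    (by fun_prop) (fun x y => by rw [hhalf, hhalf]) Real.pi 0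
  have hsum := hshift (0, 1) (0, 0)
  simp only at hsum hhalfc
  rw [hbase] at hsum
  have e1 : (0 : ℝ) + 2 * Real.pi = Real.pi + Real.pi := by ring
  have e2 : (0 : ℝ) + Real.pi = Real.pi := by ring
  rw [e1] at hsum
  rw [e2] at hhalfc
  have hz : G (Real.pi, 1) - G (0, 1) = 0 := by linear_combination (hsum - hhalfc) / 2
  have := hhalf 0
  rw [e2, hz, Complex.exp_zero] at this
  norm_num at this

/-- Invariance of domain for the plane, at the centre of the unit disc. -/
lemma image_closedBall_mem_nhds {h : ℂ → ℂ} (hc : Continuous h)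
    (hi : InjOn h (closedBall 0 1)) : h '' closedBall 0 1 ∈ nhds (h 0) := by
  by_contra hn
  have hne : ∀ z ∈ sphere (0 : ℂ) 1, h z - h 0 ≠ 0 := fun z hz h0 => by
    have := hi (sphere_subset_closedBall hz) (by simp) (sub_eq_zero.1 h0)
    simp [this] at hz
  obtain ⟨z₀, hz₀, hmin⟩ := (isCompact_sphere (0 : ℂ) 1).exists_isMinOn
    (NormedSpace.sphere_nonempty.2 zero_le_one)
    (f := fun z => ‖h z - h 0‖) (by fun_prop)
  obtain ⟨w, hw, hwh⟩ : ∃ w ∈ ball (h 0) ‖h z₀ - h 0‖, w ∉ h '' closedBall 0 1 := by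
    by_contra! hall
    exact hn (mem_of_superset (ball_mem_nhds _ (norm_pos_iff.2 (hne _ hz₀))) hall)
  obtain ⟨L, hL, hLh⟩ := exists_continuous_log (f := fun z => h (discRetraction z) - w)
    ((hc.comp continuous_discRetraction).sub continuous_const) fun z h0 =>
      hwh ⟨discRetraction z, by simpa using norm_discRetraction_le z, sub_eq_zero.1 h0⟩
  have hslit : ∀ z ∈ sphere (0 : ℂ) 1, 1 + -((w - h 0) / (h z - h 0)) ∈ slitPlane := fun z hz => by
    refine mem_slitPlane_of_norm_lt_one ?_
    rw [norm_neg, norm_div, div_lt_one (norm_pos_iff.2 (hne z hz))]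
    exact (mem_ball_iff_norm.1 hw).trans_le (hmin hz)
  refine no_continuous_log_of_injOn hc hi
    (g := fun z => L z - log (1 + -((w - h 0) / (h z - h 0)))) ?_ fun z hz => ?_
  · refine hL.continuousOn.sub (ContinuousOn.clog ?_ hslit)
    fun_prop (disch := assumption)
  · rw [Complex.exp_sub, exp_log (slitPlane_ne_zero (hslit z hz)), hLh,
      discRetraction_of_norm_le (by simpa using hz.le), div_eq_iff (slitPlane_ne_zero (hslit z hz))]
    field_simp [hne z hz]
    ring

/-- Invariance of domain for the plane: an injective continuous map of the closed unit disc is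
open on the open disc. -/
lemma isOpen_image_ball {h : ℂ → ℂ} (hc : Continuous h) (hi : InjOn h (closedBall 0 1)) :
    IsOpen (h '' ball 0 1) := by
  rw [isOpen_iff_mem_nhds]
  rintro _ ⟨a, ha, rfl⟩
  have ha' : ‖a‖ < 1 := by simpa using ha
  set r : ℝ := (1 - ‖a‖) / 2 with hr
  have hr0 : 0 < r := by linarith
  have hmaps : ∀ z ∈ closedBall (0 : ℂ) 1, a + r * z ∈ ball (0 : ℂ) 1 := fun z hz => by
    have hz : ‖z‖ ≤ 1 := by simpa using hz
    rw [mem_ball_zero_iff]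
    calc ‖a + r * z‖ ≤ ‖a‖ + r * ‖z‖ := by
          simpa [abs_of_pos hr0] using norm_add_le a (r * z)
      _ ≤ ‖a‖ + r * 1 := by gcongr
      _ < 1 := by linarith
  have key := image_closedBall_mem_nhds (h := fun z => h (a + r * z)) (by fun_prop)
    fun x hx y hy hxy => by
      have := hi (ball_subset_closedBall (hmaps x hx)) (ball_subset_closedBall (hmaps y hy)) hxy
      simpa [hr0.ne'] using this
  simp only [mul_zero, add_zero] at key
  refine mem_of_superset key ?_
  rintro _ ⟨z, hz, rfl⟩
  exact ⟨_, hmaps z hz, rfl⟩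

/-- A compact null set of reals is covered by finitely many cells of a fine uniform grid, of
arbitrarily small total length. -/
lemma exists_grid_cover {E : Set ℝ} (hE : IsCompact E) (h0 : volume E = 0) {ε : ℝ} (hε : 0 < ε) :
    ∀ᶠ n : ℕ in atTop, ∃ J : Finset ℤ, (∀ j ∈ J, ∃ θ ∈ E, |θ - j / n| ≤ 1 / n) ∧
      (∀ θ ∈ E, ∃ j ∈ J, |θ - j / n| ≤ 1 / n) ∧ (J.card : ℝ) / n ≤ ε := by
  obtain ⟨O, hEO, hO, hOε⟩ := E.exists_isOpen_lt_of_lt (μ := volume) (ENNReal.ofReal ε)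
    (by simpa [h0] using hε)
  obtain ⟨d, hd, hdO⟩ := hE.exists_thickening_subset_open hO hEO
  filter_upwards [eventually_gt_atTop 0,
    tendsto_one_div_atTop_nhds_zero_nat.eventually_lt_const hd] with n hn hnd
  have hn' : (0 : ℝ) < n := by exact_mod_cast hn
  have hcell : ∀ x : ℝ, (⌊n * x⌋ : ℝ) / n ≤ x ∧ x < ⌊n * x⌋ / n + 1 / n := fun x => by
    have h1 := Int.floor_le (n * x)
    have h2 := Int.lt_floor_add_one (n * x)
    rw [← add_div, div_le_iff₀ hn', lt_div_iff₀ hn']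
    constructor <;> linarith
  have hfin : ((fun x : ℝ => ⌊n * x⌋) '' E).Finite := by
    obtain ⟨R, hR⟩ := hE.isBounded.subset_closedBall 0
    refine (Set.finite_Icc ⌊n * (-R)⌋ ⌊n * R⌋).subset ?_
    rintro _ ⟨x, hx, rfl⟩
    have := hR hx
    rw [mem_closedBall_zero_iff, Real.norm_eq_abs, abs_le] at this
    exact ⟨Int.floor_le_floor (mul_le_mul_of_nonneg_left this.1 hn'.le),
      Int.floor_le_floor (mul_le_mul_of_nonneg_left this.2 hn'.le)⟩
  refine ⟨hfin.toFinset, fun j hj => ?_, fun θ hθ => ⟨⌊n * θ⌋, by simpa using ⟨θ, hθ, rfl⟩, ?_⟩, ?_⟩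
  · obtain ⟨θ, hθ, rfl⟩ := hfin.mem_toFinset.1 hj
    refine ⟨θ, hθ, abs_le.2 ?_⟩
    have := hcell θ
    have : 0 < 1 / (n : ℝ) := by positivity
    constructor <;> linarith
  · refine abs_le.2 ?_
    have := hcell θ
    have : 0 < 1 / (n : ℝ) := by positivity
    constructor <;> linarith
  · have hmeas : volume (⋃ j ∈ hfin.toFinset, Ico ((j : ℝ) / n) (j / n + 1 / n)) =
        ∑ j ∈ hfin.toFinset, volume (Ico ((j : ℝ) / n) (j / n + 1 / n)) := by
      refine measure_biUnion_finset (fun i _ j _ hij => ?_) fun _ _ => measurableSet_Ico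
      refine Set.disjoint_left.2 fun x hx hy => hij ?_
      have aux : ∀ k : ℤ, x ∈ Ico ((k : ℝ) / n) (k / n + 1 / n) → ⌊n * x⌋ = k := fun k hk => by
        rw [← add_div, mem_Ico, div_le_iff₀ hn', lt_div_iff₀ hn'] at hk
        exact Int.floor_eq_iff.2 ⟨by linarith, by linarith⟩
      exact (aux i hx).symm.trans (aux j hy)
    have hsub : (⋃ j ∈ hfin.toFinset, Ico ((j : ℝ) / n) (j / n + 1 / n)) ⊆ O := by
      refine iUnion₂_subset fun j hj x hx => hdO ?_
      obtain ⟨θ, hθ, rfl⟩ := hfin.mem_toFinset.1 hj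
      refine mem_thickening_iff.2 ⟨θ, hθ, ?_⟩
      have := hcell θ
      simp only [mem_Ico] at hx
      rw [Real.dist_eq, abs_lt]
      constructor <;> linarith
    have hle := (measure_mono (μ := volume) hsub).trans hOε.le
    rw [hmeas] at hle
    simp only [Real.volume_Ico, add_sub_cancel_left, Finset.sum_const, nsmul_eq_mul] at hle
    rw [← ENNReal.ofReal_natCast, ← ENNReal.ofReal_mul (by positivity),
      ENNReal.ofReal_le_ofReal_iff hε.le] at hle
    simpa [div_eq_mul_inv] using hle

/-- Membership in the disc algebra. -/
structure InDiscAlgebra (f : ℂ → ℂ) : Prop where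
  continuousOn : ContinuousOn f (closedBall 0 1)
  differentiableOn : DifferentiableOn ℂ f (ball 0 1)

namespace InDiscAlgebra

lemma add {f g : ℂ → ℂ} (hf : InDiscAlgebra f) (hg : InDiscAlgebra g) :
    InDiscAlgebra fun z => f z + g z :=
  ⟨hf.1.add hg.1, hf.2.add hg.2⟩

lemma mul {f g : ℂ → ℂ} (hf : InDiscAlgebra f) (hg : InDiscAlgebra g) :
    InDiscAlgebra fun z => f z * g z :=
  ⟨hf.1.mul hg.1, hf.2.mul hg.2⟩

lemma const (c : ℂ) : InDiscAlgebra fun _ => c :=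
  ⟨continuousOn_const, differentiableOn_const c⟩

lemma of_differentiableOn {f : ℂ → ℂ} (hf : DifferentiableOn ℂ f (closedBall 0 1)) :
    InDiscAlgebra f :=
  ⟨hf.continuousOn, hf.mono ball_subset_closedBall⟩

lemma dslope {f : ℂ → ℂ} (hf : InDiscAlgebra f) : InDiscAlgebra (dslope f 0) :=
  ⟨(continuousOn_dslope (closedBall_mem_nhds 0 one_pos)).2
    ⟨hf.1, hf.2.differentiableAt (ball_mem_nhds 0 one_pos)⟩,
   (differentiableOn_dslope (ball_mem_nhds 0 one_pos)).2 hf.2⟩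

end InDiscAlgebra

lemma re_div_bounds {ℓ : ℝ} (hℓ : 0 < ℓ) {u : ℂ} (hu : ‖u‖ ≤ 1) :
    0 ≤ ((ℓ : ℂ) / (1 + ℓ - u)).re ∧ (‖1 - u‖ ≤ ℓ → 1 / 4 ≤ ((ℓ : ℂ) / (1 + ℓ - u)).re) ∧
      (2 * ℓ ≤ ‖1 - u‖ → ‖(ℓ : ℂ) / (1 + ℓ - u)‖ ≤ 2 * ℓ / ‖1 - u‖) := by
  have hre : ℓ ≤ (1 + ℓ - u : ℂ).re := by
    have := (re_le_norm u).trans hu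
    simp; linarith
  have hpos : 0 < normSq (1 + ℓ - u) := by
    refine normSq_pos.2 fun h => ?_
    rw [h] at hre
    simp at hre
    linarith
  have hform : ((ℓ : ℂ) / (1 + ℓ - u)).re = ℓ * (1 + ℓ - u : ℂ).re / normSq (1 + ℓ - u) := by
    rw [div_re, ofReal_re, ofReal_im]; ring
  refine ⟨?_, fun h => ?_, fun h => ?_⟩
  · rw [hform]
    exact div_nonneg (mul_nonneg hℓ.le (hℓ.le.trans hre)) hpos.le
  · rw [hform, le_div_iff₀ hpos, normSq_eq_norm_sq]
    have : ‖(1 + ℓ - u : ℂ)‖ ≤ 2 * ℓ := by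
      calc ‖(1 + ℓ - u : ℂ)‖ = ‖(1 - u) + (ℓ : ℂ)‖ := by ring_nf
        _ ≤ ‖1 - u‖ + ‖(ℓ : ℂ)‖ := norm_add_le _ _
        _ ≤ 2 * ℓ := by rw [norm_real, Real.norm_of_nonneg hℓ.le]; linarith
    have h2 := mul_le_mul_of_nonneg_left hre hℓ.le
    nlinarith [norm_nonneg (1 + ℓ - u : ℂ)]
  · have : ‖1 - u‖ / 2 ≤ ‖(1 + ℓ - u : ℂ)‖ := by
      have h1 := norm_sub_le (1 + ℓ - u : ℂ) ℓ
      rw [norm_real, Real.norm_of_nonneg hℓ.le, show (1 + ℓ - u : ℂ) - ℓ = 1 - u by ring] at h1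
      linarith
    have h0 : 0 < ‖1 - u‖ := by linarith
    rw [norm_div, norm_real, Real.norm_of_nonneg hℓ.le, div_le_div_iff₀ (by linarith) h0]
    nlinarith

/-- Fatou's lemma on null sets: functions in the disc algebra with nonnegative real part, bounded
below on `K` and small away from `K`. -/
lemma exists_re_ge_on_null {K : Set ℂ} (hKc : IsCompact K) (hKs : K ⊆ sphere 0 1)
    (hK0 : arclength K = 0) {N : Set ℂ} (hN : IsOpen N) (hKN : K ⊆ N) {ε : ℝ} (hε : 0 < ε) :
    ∃ G : ℂ → ℂ, DifferentiableOn ℂ G (closedBall 0 1) ∧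
      (∀ z ∈ closedBall (0 : ℂ) 1, 0 ≤ (G z).re) ∧ (∀ z ∈ K, 1 / 4 ≤ (G z).re) ∧
      ∀ z ∈ closedBall (0 : ℂ) 1 \ N, ‖G z‖ ≤ ε := by
  obtain ⟨d, hd, hdN⟩ := hKc.exists_thickening_subset_open hN hKN
  set E : Set ℝ := circleMap 0 1 ⁻¹' K ∩ Icc 0 (2 * Real.pi) with hEdef
  have hE : IsCompact E :=
    isCompact_Icc.inter_left (hKc.isClosed.preimage (continuous_circleMap 0 1))
  have hE0 : volume E = 0 := by
    rw [arclength, Measure.map_apply (continuous_circleMap 0 1).measurable hKc.measurableSet,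
      restrict_Ioc_eq_restrict_Icc,
      Measure.restrict_apply ((continuous_circleMap 0 1).measurable hKc.measurableSet)] at hK0
    exact hK0
  obtain ⟨n, ⟨J, hJE, hEJ, hJ⟩, hnd, hn⟩ :=
    ((exists_grid_cover hE hE0 (ε := ε * (d / 4)) (by positivity)).and
      ((tendsto_one_div_atTop_nhds_zero_nat.eventually_lt_const
        (show (0 : ℝ) < d / 4 by positivity)).and (eventually_gt_atTop 0))).exists
  set ℓ : ℝ := 1 / n with hℓdef
  have hℓ : 0 < ℓ := by positivity
  let c : ℤ → ℂ := fun j => exp (I * (j / n : ℝ))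
  have hc1 : ∀ j, ‖c j‖ = 1 := fun j => norm_exp_I_mul_ofReal _
  have hc0 : ∀ j, c j ≠ 0 := fun j => exp_ne_zero _
  have hu : ∀ j, ∀ z ∈ closedBall (0 : ℂ) 1, ‖z / c j‖ ≤ 1 := fun j z hz => by
    simpa [hc1] using hz
  have hdist : ∀ j z, ‖1 - z / c j‖ = ‖c j - z‖ := fun j z => by
    rw [one_sub_div (hc0 j), norm_div, hc1, div_one]
  have hcθ : ∀ (j : ℤ) (θ : ℝ), |θ - j / n| ≤ ℓ → ‖c j - circleMap 0 1 θ‖ ≤ ℓ := fun j θ h => by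
    have : c j - circleMap 0 1 θ = -(c j * (exp (I * (θ - j / n : ℝ)) - 1)) := by
      simp only [c, circleMap, mul_sub, ← Complex.exp_add]
      push_cast
      rw [show I * (j / n : ℂ) + I * (θ - j / n) = θ * I by ring]
      ring
    rw [this, norm_neg, norm_mul, hc1, one_mul]
    exact Real.norm_exp_I_mul_ofReal_sub_one_le.trans h
  refine ⟨fun z => ∑ j ∈ J, (ℓ : ℂ) / (1 + ℓ - z / c j), ?_, fun z hz => ?_, fun z hz => ?_,
    fun z hz => ?_⟩
  · refine DifferentiableOn.fun_sum fun j _ => ?_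
    refine DifferentiableOn.div (by fun_prop) (by fun_prop) fun z hz h0 => ?_
    have h1 := (re_le_norm _).trans (hu j z hz)
    have h2 := congrArg re h0
    simp only [add_re, sub_re, one_re, ofReal_re, zero_re] at h2
    linarith
  · rw [re_sum]
    exact Finset.sum_nonneg fun j _ => (re_div_bounds hℓ (hu j z hz)).1
  · have hzs := hKs hz
    obtain ⟨θ, hθ, rfl⟩ : ∃ θ ∈ Icc (0 : ℝ) (2 * Real.pi), circleMap 0 1 θ = z := by
      have : z ∈ circleMap 0 1 '' Ioc 0 (2 * Real.pi) := by
        rw [image_circleMap_Ioc]; simpa using hzs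
      obtain ⟨θ, hθ, h⟩ := this
      exact ⟨θ, Ioc_subset_Icc_self hθ, h⟩
    obtain ⟨j, hj, hjθ⟩ := hEJ θ ⟨hz, hθ⟩
    have hz' := sphere_subset_closedBall hzs
    rw [re_sum]
    exact ((re_div_bounds hℓ (hu j _ hz')).2.1 (by rw [hdist]; exact hcθ j θ hjθ)).trans
      (Finset.single_le_sum (f := fun j => ((ℓ : ℂ) / (1 + ℓ - circleMap 0 1 θ / c j)).re)
        (fun i _ => (re_div_bounds hℓ (hu i _ hz')).1) hj)
  · refine (norm_sum_le _ _).trans ((Finset.sum_le_card_nsmul J _ (2 * ℓ / (d / 2))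
      fun j hj => ?_).trans ?_)
    · obtain ⟨θ, hθ, hjθ⟩ := hJE j hj
      have hfar : d ≤ ‖z - circleMap 0 1 θ‖ := by
        by_contra! hlt
        exact hz.2 (hdN (mem_thickening_iff.2 ⟨_, hθ.1, by rwa [dist_eq_norm]⟩))
      have hj' := hcθ j θ hjθ
      have htri := norm_sub_le_norm_sub_add_norm_sub z (c j) (circleMap 0 1 θ)
      rw [norm_sub_rev z (c j)] at htri
      have hge : d / 2 ≤ ‖1 - z / c j‖ := by rw [hdist]; linarith
      refine ((re_div_bounds hℓ (hu j z hz.1)).2.2 (by linarith)).trans ?_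
      gcongr
    · rw [nsmul_eq_mul]
      calc (J.card : ℝ) * (2 * ℓ / (d / 2)) = (J.card : ℝ) / n * (4 / d) := by
            rw [hℓdef]; field_simp; ring
        _ ≤ ε * (d / 4) * (4 / d) := by gcongr
        _ = ε := by field_simp

/-- Approximate peak functions for closed null subsets of the circle. -/
lemma exists_approx_peak {K : Set ℂ} (hKc : IsCompact K) (hKs : K ⊆ sphere 0 1)
    (hK0 : arclength K = 0) {N : Set ℂ} (hN : IsOpen N) (hKN : K ⊆ N) {ε : ℝ} (hε : 0 < ε) :
    ∃ q : ℂ → ℂ, InDiscAlgebra q ∧ (∀ z ∈ closedBall (0 : ℂ) 1, ‖q z‖ ≤ 1) ∧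
      (∀ z ∈ K, ‖q z - 1‖ ≤ ε) ∧ ∀ z ∈ closedBall (0 : ℂ) 1 \ N, ‖q z‖ ≤ ε := by
  obtain ⟨G, hG, hGre, hGK, hGN⟩ := exists_re_ge_on_null hKc hKs hK0 hN hKN
    (ε := ε * (ε / 4)) (by positivity)
  set M : ℝ := 4 / ε with hM
  have hM0 : 0 < M := by positivity
  have hre : ∀ z, (1 + M * G z : ℂ).re = 1 + M * (G z).re := fun z => by simp
  have hge : ∀ z ∈ closedBall (0 : ℂ) 1, 1 ≤ ‖(1 + M * G z : ℂ)‖ := fun z hz => by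
    refine le_trans ?_ (re_le_norm _)
    rw [hre]
    nlinarith [hGre z hz]
  have hne : ∀ z ∈ closedBall (0 : ℂ) 1, (1 + M * G z : ℂ) ≠ 0 := fun z hz =>
    norm_pos_iff.1 (one_pos.trans_le (hge z hz))
  refine ⟨fun z => M * G z / (1 + M * G z), .of_differentiableOn ?_, fun z hz => ?_,
    fun z hz => ?_, fun z hz => ?_⟩
  · exact DifferentiableOn.div (by fun_prop) (by fun_prop) hne
  · rw [norm_div, div_le_one (one_pos.trans_le (hge z hz))]
    rw [← sq_le_sq₀ (norm_nonneg _) (norm_nonneg _), ← normSq_eq_norm_sq, ← normSq_eq_norm_sq]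
    have := mul_nonneg hM0.le (hGre z hz)
    simp only [normSq_apply, hre]
    simp
    nlinarith
  · have hz' := sphere_subset_closedBall (hKs hz)
    have : M * G z / (1 + M * G z) - 1 = -(1 / (1 + M * G z) : ℂ) := by
      field_simp [hne z hz']
      ring
    rw [this, norm_neg, norm_div, norm_one, div_le_iff₀ (one_pos.trans_le (hge z hz'))]
    have h1 := re_le_norm (1 + M * G z : ℂ)
    rw [hre] at h1
    have h2 := mul_le_mul_of_nonneg_left (hGK z hz) hM0.le
    have h3 : M * (1 / 4) = 1 / ε := by rw [hM]; field_simp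
    calc (1 : ℝ) = ε * (1 / ε) := by field_simp
      _ ≤ ε * ‖(1 + M * G z : ℂ)‖ := by gcongr; linarith
  · rw [norm_div]
    refine (div_le_self (norm_nonneg _) (hge z hz.1)).trans ?_
    rw [norm_mul, norm_real, Real.norm_of_nonneg hM0.le]
    calc M * ‖G z‖ ≤ M * (ε * (ε / 4)) := by gcongr; exact hGN z hz
      _ = ε := by rw [hM]; field_simp

/-- Restrictions of disc algebra functions are dense in the continuous functions on a closed null
subset of the circle. -/
lemma exists_inDiscAlgebra_near {K : Set ℂ} (hKc : IsCompact K) (hKs : K ⊆ sphere 0 1)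
    (hK0 : arclength K = 0) {δ : ℂ → ℂ} (hδ : ContinuousOn δ K) {ε : ℝ} (hε : 0 < ε) :
    ∃ p : ℂ → ℂ, InDiscAlgebra p ∧ ∀ z ∈ K, ‖p z - δ z‖ < ε := by
  have : CompactSpace K := isCompact_iff_compactSpace.1 hKc
  have key : ∀ F : C(K, ℂ), ∀ ε > 0, ∃ p : ℂ → ℂ, InDiscAlgebra p ∧
      ∀ z : K, ‖p z - F z‖ < ε := by
    intro F
    induction F using ContinuousMap.induction_on_of_compact with
    | const r => exact fun ε hε => ⟨fun _ => r, .const r, fun z => by simpa using hε⟩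
    | id => exact fun ε hε => ⟨fun z => z, .of_differentiableOn differentiableOn_id,
        fun z => by simpa using hε⟩
    | star_id =>
      intro ε hε
      have hne : ∀ z ∈ K, z ≠ 0 := fun z hz => ne_zero_of_mem_unit_sphere ⟨z, hKs hz⟩
      obtain ⟨q, hq, -, hqK, hq0⟩ := exists_approx_peak hKc hKs hK0
        (isOpen_compl_singleton (x := (0 : ℂ))) hne (ε := ε / 3) (by positivity)
      refine ⟨_, hq.dslope, fun z => ?_⟩
      have hz := hKs z.2
      have hz1 : ‖(z : ℂ)‖ = 1 := by simpa using hz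
      have hstar : star (z : ℂ) = (z : ℂ)⁻¹ := by
        rw [Complex.inv_def, normSq_eq_norm_sq, hz1]; simp
      have hval : dslope q 0 z - (star ((ContinuousMap.id ℂ).restrict K)) z =
          (z : ℂ)⁻¹ * ((q z - 1) - q 0) := by
        rw [dslope_of_ne _ (hne z z.2), slope_def_field]
        change _ - star (z : ℂ) = _
        rw [hstar]
        field_simp
        ring
      rw [hval, norm_mul, norm_inv, hz1, inv_one, one_mul]
      have h1 := hqK z z.2
      have h2 := hq0 0 ⟨by simp, by simp⟩
      have h3 := norm_sub_le (q z - 1) (q 0)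
      linarith
    | add f g hf hg =>
      intro ε hε
      obtain ⟨p, hp, hpf⟩ := hf (ε / 2) (by positivity)
      obtain ⟨q, hq, hqg⟩ := hg (ε / 2) (by positivity)
      refine ⟨_, hp.add hq, fun z => ?_⟩
      rw [ContinuousMap.add_apply, add_sub_add_comm]
      exact (norm_add_le _ _).trans_lt (by linarith [hpf z, hqg z])
    | mul f g hf hg =>
      intro ε hε
      have hfn := norm_nonneg f
      have hgn := norm_nonneg g
      set C : ℝ := ‖f‖ + ‖g‖ + 1 with hC
      have hC0 : 0 < C := by positivity
      obtain ⟨p, hp, hpf⟩ := hf (min 1 (ε / C)) (by positivity)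
      obtain ⟨q, hq, hqg⟩ := hg (ε / C) (by positivity)
      refine ⟨_, hp.mul hq, fun z => ?_⟩
      have e : p z * q z - (f * g) z = p z * (q z - g z) + (p z - f z) * g z := by
        rw [ContinuousMap.mul_apply]; ring
      have hpz : ‖p z‖ ≤ ‖f‖ + 1 := by
        have h1 := norm_le_norm_add_norm_sub (f z) (p z)
        have h2 := f.norm_coe_le_norm z
        have h3 := (hpf z).le.trans (min_le_left _ _)
        rw [norm_sub_rev] at h3
        linarith
      have hgz := g.norm_coe_le_norm z
      have h1 := (hpf z).trans_le (min_le_right _ _)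
      have h2 := hqg z
      rw [e]
      calc ‖p z * (q z - g z) + (p z - f z) * g z‖
          ≤ ‖p z‖ * ‖q z - g z‖ + ‖p z - f z‖ * ‖g z‖ := by
            rw [← norm_mul, ← norm_mul]; exact norm_add_le _ _
        _ ≤ (‖f‖ + 1) * ‖q z - g z‖ + ε / C * ‖g‖ := by gcongr
        _ < (‖f‖ + 1) * (ε / C) + ε / C * ‖g‖ := by gcongr
        _ = ε := by rw [hC]; field_simp; ring
    | frequently f hf =>
      intro ε hε
      obtain ⟨g, hg, hgf⟩ := (hf.and_eventually (ball_mem_nhds f (half_pos hε))).exists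
      obtain ⟨p, hp, hpg⟩ := hg (ε / 2) (by positivity)
      refine ⟨p, hp, fun z => ?_⟩
      have h1 := (g - f).norm_coe_le_norm z
      rw [← dist_eq_norm] at h1
      have h2 := norm_sub_le_norm_sub_add_norm_sub (p z) (g z) (f z)
      have h3 := hpg z
      have h4 : dist g f < ε / 2 := hgf
      rw [ContinuousMap.sub_apply] at h1
      linarith
  obtain ⟨p, hp, h⟩ := key ⟨K.domRestrict δ, hδ.domRestrict⟩ ε hε
  exact ⟨p, hp, fun z hz => h ⟨z, hz⟩⟩

/-- Approximate Rudin–Carleson interpolation, localized near `K`. -/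
lemma exists_local_interpolation {K : Set ℂ} (hKc : IsCompact K) (hKs : K ⊆ sphere 0 1)
    (hK0 : arclength K = 0) {δ : ℂ → ℂ} (hδ : ContinuousOn δ K) {r : ℝ} (hr : 0 ≤ r)
    (hδr : ∀ z ∈ K, ‖δ z‖ ≤ r) {N : Set ℂ} (hN : IsOpen N) (hKN : K ⊆ N)
    {ε : ℝ} (hε : 0 < ε) :
    ∃ e : ℂ → ℂ, InDiscAlgebra e ∧ (∀ z ∈ K, ‖e z - δ z‖ < ε) ∧
      (∀ z ∈ closedBall (0 : ℂ) 1, ‖e z‖ < r + ε) ∧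
      ∀ z ∈ closedBall (0 : ℂ) 1 \ N, ‖e z‖ < ε := by
  obtain ⟨p, hp, hpδ⟩ := exists_inDiscAlgebra_near hKc hKs hK0 hδ (half_pos hε)
  obtain ⟨C, hC⟩ := (isCompact_closedBall (0 : ℂ) 1).exists_bound_of_continuousOn hp.1
  have hC0 : 0 ≤ C := (norm_nonneg _).trans (hC 0 (by simp))
  obtain ⟨O, hO, hOeq⟩ := (_root_.continuousOn_iff'.1 hp.1.norm) (Iio (r + ε)) isOpen_Iio
  have hKD : K ⊆ closedBall 0 1 := hKs.trans sphere_subset_closedBall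
  have hKO : K ⊆ N ∩ O := fun z hz => by
    refine ⟨hKN hz, (hOeq.subset ⟨?_, hKD hz⟩).1⟩
    have := norm_le_norm_add_norm_sub (δ z) (p z)
    have h1 := hpδ z hz
    rw [norm_sub_rev] at h1
    have h2 := hδr z hz
    rw [mem_preimage, mem_Iio]
    linarith
  obtain ⟨q, hq, hq1, hqK, hqN⟩ := exists_approx_peak hKc hKs hK0 (hN.inter hO) hKO
    (ε := ε / 2 / (C + 1)) (by positivity)
  have hsmall : C * (ε / 2 / (C + 1)) < ε / 2 := by
    rw [mul_div_assoc', div_lt_iff₀ (by positivity)]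
    nlinarith
  have hoff : ∀ z ∈ closedBall (0 : ℂ) 1 \ (N ∩ O), ‖p z * q z‖ < ε := fun z hz => by
    rw [norm_mul]
    have := mul_le_mul (hC z hz.1) (hqN z hz) (norm_nonneg _) hC0
    linarith
  refine ⟨_, hp.mul hq, fun z hz => ?_, fun z hz => ?_, fun z hz => hoff z ⟨hz.1, fun h => hz.2 h.1⟩⟩
  · have h1 : ‖p z * (q z - 1)‖ ≤ C * (ε / 2 / (C + 1)) := by
      rw [norm_mul]
      exact mul_le_mul (hC z (hKD hz)) (hqK z hz) (norm_nonneg _) hC0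
    calc ‖p z * q z - δ z‖ = ‖p z * (q z - 1) + (p z - δ z)‖ := by ring_nf
      _ ≤ ‖p z * (q z - 1)‖ + ‖p z - δ z‖ := norm_add_le _ _
      _ < ε := by linarith [hpδ z hz]
  · by_cases h : z ∈ N ∩ O
    · have h1 : ‖p z‖ < r + ε := (hOeq.superset ⟨h.2, hz⟩).1
      rw [norm_mul]
      exact (mul_le_of_le_one_right (norm_nonneg _) (hq1 z hz)).trans_lt h1
    · exact (hoff z ⟨hz, h⟩).trans_le (by linarith)

/-- One interpolation step: a function in the disc algebra with values in the open set `U` that is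
close to `ψ` on `K` can be moved so as to be close to the nearby function `ψ'` on `K`. -/
lemma exists_interpolation_step {K : Set ℂ} (hKc : IsCompact K) (hKs : K ⊆ sphere 0 1)
    (hK0 : arclength K = 0) {U : Set ℂ} (hU : IsOpen U) {f₀ f ψ ψ' : ℂ → ℂ} {ρ ω τ : ℝ}
    (hf₀ : InDiscAlgebra f₀) (hf : InDiscAlgebra f) (hfU : MapsTo f (closedBall 0 1) U)
    (hψ' : ContinuousOn ψ' K) (hρ : 0 < ρ) (hτ : 0 < τ)
    (hfψ : ∀ k ∈ K, ‖f k - ψ k‖ < ρ) (hψψ' : ∀ k ∈ K, ‖ψ' k - ψ k‖ < ρ)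
    (hball : ∀ k ∈ K, ball (ψ k) (4 * ρ) ⊆ U)
    (hff₀ : ∀ z ∈ closedBall (0 : ℂ) 1, ‖f z - f₀ z‖ < ω)
    (hψf₀ : ∀ k ∈ K, ‖ψ k - f₀ k‖ + 5 * ρ ≤ ω) :
    ∃ f' : ℂ → ℂ, InDiscAlgebra f' ∧ MapsTo f' (closedBall 0 1) U ∧
      (∀ k ∈ K, ‖f' k - ψ' k‖ < τ) ∧ ∀ z ∈ closedBall (0 : ℂ) 1, ‖f' z - f₀ z‖ < ω := by
  have hD := isCompact_closedBall (0 : ℂ) 1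
  have hKD : K ⊆ closedBall 0 1 := hKs.trans sphere_subset_closedBall
  obtain ⟨ε₁, hε₁, hε₁U⟩ := (hD.image_of_continuousOn hf.1).exists_thickening_subset_open hU
    hfU.image_subset
  obtain ⟨z₀, hz₀, hmax⟩ := hD.exists_isMaxOn ⟨0, by simp⟩ (hf.1.sub hf₀.1).norm
  obtain ⟨d₁, hd₁, hfd⟩ := Metric.uniformContinuousOn_iff.1
    (hD.uniformContinuousOn_of_continuous hf.1) (ρ / 2) (by positivity)
  obtain ⟨d₂, hd₂, hfd₀⟩ := Metric.uniformContinuousOn_iff.1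
    (hD.uniformContinuousOn_of_continuous hf₀.1) (ρ / 2) (by positivity)
  set η : ℝ := min (min τ ε₁) (min (ω - ‖f z₀ - f₀ z₀‖) (ρ / 2)) with hη
  have hη0 : 0 < η := by
    have := hff₀ z₀ hz₀
    simp only [hη, lt_min_iff, sub_pos]
    exact ⟨⟨hτ, hε₁⟩, this, by positivity⟩
  have hητ : η ≤ τ := (min_le_left _ _).trans (min_le_left _ _)
  have hηε₁ : η ≤ ε₁ := (min_le_left _ _).trans (min_le_right _ _)
  have hηω : η ≤ ω - ‖f z₀ - f₀ z₀‖ := (min_le_right _ _).trans (min_le_left _ _)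
  have hηρ : η ≤ ρ / 2 := (min_le_right _ _).trans (min_le_right _ _)
  obtain ⟨e, he, heK, heD, heN⟩ := exists_local_interpolation hKc hKs hK0
    (δ := fun k => ψ' k - f k) (hψ'.sub (hf.1.mono hKD)) (r := 2 * ρ) (by positivity)
    (fun k hk => by
      have h1 := norm_sub_le_norm_sub_add_norm_sub (ψ' k) (ψ k) (f k)
      have h2 := hfψ k hk
      rw [norm_sub_rev] at h2
      linarith [hψψ' k hk])
    (isOpen_thickening (δ := min d₁ d₂) (E := K)) (self_subset_thickening (by positivity) K) hη0
  have hnear : ∀ z ∈ closedBall (0 : ℂ) 1, z ∈ thickening (min d₁ d₂) K →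
      ∃ k ∈ K, ‖f z + e z - ψ k‖ < 4 * ρ ∧ ‖f₀ z - f₀ k‖ < ρ / 2 := fun z hz hzN => by
    obtain ⟨k, hk, hzk⟩ := mem_thickening_iff.1 hzN
    have h1 := hfd z hz k (hKD hk) (hzk.trans_le (min_le_left _ _))
    have h2 := hfd₀ z hz k (hKD hk) (hzk.trans_le (min_le_right _ _))
    rw [dist_eq_norm] at h1 h2
    refine ⟨k, hk, ?_, h2⟩
    have h3 : ‖f z + e z - ψ k‖ ≤ ‖f z - f k‖ + ‖f k - ψ k‖ + ‖e z‖ := by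
      rw [show f z + e z - ψ k = (f z - f k) + (f k - ψ k) + e z by ring]
      exact norm_add₃_le
    linarith [hfψ k hk, heD z hz]
  refine ⟨_, hf.add he, fun z hz => ?_, fun k hk => ?_, fun z hz => ?_⟩
  · by_cases hzN : z ∈ thickening (min d₁ d₂) K
    · obtain ⟨k, hk, hzk, -⟩ := hnear z hz hzN
      exact hball k hk (mem_ball_iff_norm.2 hzk)
    · refine hε₁U (mem_thickening_iff.2 ⟨f z, mem_image_of_mem f hz, ?_⟩)
      rw [dist_eq_norm, add_sub_cancel_left]
      exact (heN z ⟨hz, hzN⟩).trans_le hηε₁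
  · rw [show f k + e k - ψ' k = e k - (ψ' k - f k) by ring]
    exact (heK k hk).trans_le hητ
  · by_cases hzN : z ∈ thickening (min d₁ d₂) K
    · obtain ⟨k, hk, hzk, hzk₀⟩ := hnear z hz hzN
      have h3 : ‖f z + e z - f₀ z‖ ≤ ‖f z + e z - ψ k‖ + ‖ψ k - f₀ k‖ + ‖f₀ k - f₀ z‖ := by
        rw [show f z + e z - f₀ z = (f z + e z - ψ k) + (ψ k - f₀ k) + (f₀ k - f₀ z) by ring]
        exact norm_add₃_le
      rw [norm_sub_rev (f₀ k)] at h3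
      linarith [hψf₀ k hk]
    · have h1 := heN z ⟨hz, hzN⟩
      have h2 : ‖f z - f₀ z‖ ≤ ‖f z₀ - f₀ z₀‖ := hmax hz
      have h3 := norm_add_le (f z - f₀ z) (e z)
      rw [show f z + e z - f₀ z = (f z - f₀ z) + e z by ring]
      linarith

/-- Interpolation along a homotopy `Φ` inside `U`, with control of the total displacement. -/
lemma exists_interpolation_along {K : Set ℂ} (hKc : IsCompact K) (hKs : K ⊆ sphere 0 1)
    (hK0 : arclength K = 0) {U : Set ℂ} (hU : IsOpen U) {Φ : ℝ → ℂ → ℂ} {a b ω : ℝ} (hab : a ≤ b)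
    (hΦ : ContinuousOn (fun p : ℝ × ℂ => Φ p.1 p.2) (Icc a b ×ˢ K))
    (hΦU : ∀ s ∈ Icc a b, ∀ k ∈ K, Φ s k ∈ U) (hω : 0 < ω)
    (hΦω : ∀ s ∈ Icc a b, ∀ k ∈ K, ‖Φ s k - Φ a k‖ ≤ ω / 2) :
    ∃ ρ > 0, ∀ f : ℂ → ℂ, InDiscAlgebra f → MapsTo f (closedBall 0 1) U →
      (∀ k ∈ K, ‖f k - Φ a k‖ < ρ) → ∀ τ > 0, ∃ f' : ℂ → ℂ, InDiscAlgebra f' ∧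
        MapsTo f' (closedBall 0 1) U ∧ (∀ k ∈ K, ‖f' k - Φ b k‖ < τ) ∧
        ∀ z ∈ closedBall (0 : ℂ) 1, ‖f' z - f z‖ < ω := by
  have hIK : IsCompact (Icc a b ×ˢ K) := isCompact_Icc.prod hKc
  obtain ⟨d, hd, hdU⟩ := (hIK.image_of_continuousOn hΦ).exists_thickening_subset_open hU (by
    rintro _ ⟨p, hp, rfl⟩; exact hΦU _ hp.1 _ hp.2)
  set ρ : ℝ := min (d / 4) (ω / 12) with hρ
  have hρ0 : 0 < ρ := by positivity
  have hρd : 4 * ρ ≤ d := by linarith [min_le_left (d / 4) (ω / 12)]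
  have hρω : 12 * ρ ≤ ω := by linarith [min_le_right (d / 4) (ω / 12)]
  obtain ⟨η, hη, hΦη⟩ := Metric.uniformContinuousOn_iff.1
    (hIK.uniformContinuousOn_of_continuous hΦ) ρ hρ0
  obtain ⟨n, hn⟩ := exists_nat_gt ((b - a) / η)
  have hn0 : (0 : ℝ) < n := (div_nonneg (sub_nonneg.2 hab) hη.le).trans_lt hn
  let s : ℕ → ℝ := fun i => a + (b - a) / n * i
  have hstep : 0 ≤ (b - a) / n := div_nonneg (sub_nonneg.2 hab) hn0.le
  have hs : ∀ i ≤ n, s i ∈ Icc a b := fun i hi => by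
    have hi' : (i : ℝ) ≤ n := by exact_mod_cast hi
    refine ⟨by simp only [s]; linarith [mul_nonneg hstep i.cast_nonneg], ?_⟩
    calc s i ≤ a + (b - a) / n * n := by simp only [s]; gcongr
      _ = b := by field_simp; ring
  have hsn : s n = b := by simp only [s]; field_simp; ring
  refine ⟨ρ, hρ0, fun f hf hfU hfa τ hτ => ?_⟩
  have hcont : ∀ t ∈ Icc a b, ContinuousOn (Φ t) K := fun t ht =>
    hΦ.comp (f := fun k => (t, k)) (by fun_prop) fun k hk => ⟨ht, hk⟩
  have hball : ∀ t ∈ Icc a b, ∀ k ∈ K, ball (Φ t k) (4 * ρ) ⊆ U := fun t ht k hk w hw =>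
    hdU (mem_thickening_iff.2 ⟨_, ⟨(t, k), ⟨ht, hk⟩, rfl⟩, (mem_ball.1 hw).trans_le hρd⟩)
  have hdisp : ∀ t ∈ Icc a b, ∀ k ∈ K, ‖Φ t k - f k‖ + 5 * ρ ≤ ω := fun t ht k hk => by
    have h1 := norm_sub_le_norm_sub_add_norm_sub (Φ t k) (Φ a k) (f k)
    have h2 := hfa k hk
    rw [norm_sub_rev] at h2
    linarith [hΦω t ht k hk]
  have hind : ∀ i ≤ n, ∃ f' : ℂ → ℂ, InDiscAlgebra f' ∧ MapsTo f' (closedBall 0 1) U ∧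
      (∀ k ∈ K, ‖f' k - Φ (s i) k‖ < ρ) ∧ ∀ z ∈ closedBall (0 : ℂ) 1, ‖f' z - f z‖ < ω := by
    intro i
    induction i with
    | zero => exact fun _ => ⟨f, hf, hfU, by simpa [s] using hfa, fun z _ => by simpa using hω⟩
    | succ i ih =>
      intro hi
      have hi' : i ≤ n := by omega
      obtain ⟨g, hg, hgU, hgs, hgf⟩ := ih hi'
      refine exists_interpolation_step hKc hKs hK0 hU hf hg hgU (hcont _ (hs _ hi)) hρ0 hρ0 hgs
        (fun k hk => ?_) (hball _ (hs _ hi')) hgf (hdisp _ (hs _ hi'))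
      rw [← dist_eq_norm]
      refine hΦη (s (i + 1), k) ⟨hs _ hi, hk⟩ (s i, k) ⟨hs _ hi', hk⟩ ?_
      rw [Prod.dist_eq, dist_self, max_eq_left dist_nonneg, Real.dist_eq]
      have : s (i + 1) - s i = (b - a) / n := by simp only [s]; push_cast; ring
      rw [this, abs_of_nonneg hstep]
      rw [div_lt_iff₀ hη] at hn
      rw [div_lt_iff₀ hn0]
      linarith
  obtain ⟨g, hg, hgU, hgs, hgf⟩ := hind n le_rfl
  rw [hsn] at hgs
  have hb : b ∈ Icc a b := right_mem_Icc.2 hab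
  exact exists_interpolation_step hKc hKs hK0 hU hf hg hgU (hcont b hb) hρ0 hτ hgs
    (fun k _ => by simpa using hρ0) (hball b hb) hgf (hdisp b hb)

/-- The limit of a rapidly Cauchy sequence in the disc algebra. -/
lemma exists_limit_of_geometric {f : ℕ → ℂ → ℂ} (hf : ∀ n, InDiscAlgebra (f n))
    (hff : ∀ n, ∀ z ∈ closedBall (0 : ℂ) 1, ‖f (n + 1) z - f n z‖ < (1 / 2) ^ n) :
    ∃ F : ℂ → ℂ, InDiscAlgebra F ∧
      ∀ z ∈ closedBall (0 : ℂ) 1, Tendsto (fun n => f n z) atTop (nhds (F z)) := by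
  have hdist : ∀ z ∈ closedBall (0 : ℂ) 1, ∀ n, dist (f n z) (f (n + 1) z) ≤ 1 * (1 / 2) ^ n :=
    fun z hz n => by rw [dist_comm, dist_eq_norm, one_mul]; exact (hff n z hz).le
  have hlim : ∀ z ∈ closedBall (0 : ℂ) 1, ∃ l, Tendsto (fun n => f n z) atTop (nhds l) :=
    fun z hz => cauchySeq_tendsto_of_complete
      (cauchySeq_of_le_geometric (1 / 2) 1 (by norm_num) (hdist z hz))
  choose! F hF using hlim
  have hunif : TendstoUniformlyOn f F atTop (closedBall 0 1) := by
    rw [Metric.tendstoUniformlyOn_iff]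
    intro ε hε
    have h0 : Tendsto (fun n : ℕ => (1 : ℝ) * (1 / 2) ^ n / (1 - 1 / 2)) atTop (nhds 0) := by
      have := tendsto_pow_atTop_nhds_zero_of_lt_one (r := (1 / 2 : ℝ)) (by norm_num) (by norm_num)
      simpa using (this.const_mul 1).div_const (1 - 1 / 2)
    filter_upwards [h0.eventually_lt_const hε] with n hn z hz
    rw [dist_comm]
    exact (dist_le_of_le_geometric_of_tendsto (1 / 2) 1 (by norm_num) (hdist z hz) (hF z hz)
      n).trans_lt hn
  refine ⟨F, ⟨hunif.continuousOn (Frequently.of_forall fun n => (hf n).1), ?_⟩, hF⟩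
  exact (hunif.mono ball_subset_closedBall).tendstoLocallyUniformlyOn.differentiableOn
    (Eventually.of_forall fun n => (hf n).2) isOpen_ball

/-- Interpolation of the endpoint of a homotopy which starts at a constant and stays in the open
set `U` up to its end. -/
lemma exists_interpolation_of_homotopy {K : Set ℂ} (hKc : IsCompact K) (hKs : K ⊆ sphere 0 1)
    (hK0 : arclength K = 0) {U T : Set ℂ} (hU : IsOpen U) (hT : IsClosed T) (hUT : U ⊆ T)
    {Φ : ℝ → ℂ → ℂ} (hΦ : ContinuousOn (fun p : ℝ × ℂ => Φ p.1 p.2) (Icc 0 1 ×ˢ K))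
    (hΦU : ∀ s ∈ Ico (0 : ℝ) 1, ∀ k ∈ K, Φ s k ∈ U) {c : ℂ} (hc : c ∈ U)
    (hΦ0 : ∀ k ∈ K, Φ 0 k = c) :
    ∃ F : ℂ → ℂ, InDiscAlgebra F ∧ MapsTo F (closedBall 0 1) T ∧ ∀ k ∈ K, F k = Φ 1 k := by
  have hIK : IsCompact (Icc (0 : ℝ) 1 ×ˢ K) := isCompact_Icc.prod hKc
  have hKD : K ⊆ closedBall 0 1 := hKs.trans sphere_subset_closedBall
  have hunif : ∀ n : ℕ, ∀ᶠ m : ℕ in atTop, ∀ s ∈ Icc (1 - 1 / ((m : ℝ) + 1)) 1,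
      ∀ s' ∈ Icc (1 - 1 / ((m : ℝ) + 1)) 1, ∀ k ∈ K, ‖Φ s k - Φ s' k‖ ≤ (1 / 2) ^ n / 2 := by
    intro n
    obtain ⟨η, hη, hΦη⟩ := Metric.uniformContinuousOn_iff.1
      (hIK.uniformContinuousOn_of_continuous hΦ) ((1 / 2) ^ n / 2) (by positivity)
    filter_upwards [tendsto_one_div_add_atTop_nhds_zero_nat.eventually_lt_const hη] with m hm
      s hs s' hs' k hk
    have hm1 : 1 / ((m : ℝ) + 1) ≤ 1 := by
      rw [div_le_one (by positivity)]; linarith [m.cast_nonneg (α := ℝ)]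
    rw [← dist_eq_norm]
    refine (hΦη (s, k) ⟨⟨by linarith [hs.1], hs.2⟩, hk⟩ (s', k)
      ⟨⟨by linarith [hs'.1], hs'.2⟩, hk⟩ ?_).le
    rw [Prod.dist_eq, dist_self, max_eq_left dist_nonneg, Real.dist_eq, abs_lt]
    constructor <;> linarith [hs.1, hs.2, hs'.1, hs'.2]
  obtain ⟨m, hm, hmΦ⟩ := extraction_forall_of_eventually hunif
  let t : ℕ → ℝ := fun n => 1 - 1 / ((m n : ℝ) + 1)
  have ht0 : ∀ n, 0 ≤ t n := fun n => by
    have : 1 / ((m n : ℝ) + 1) ≤ 1 := by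
      rw [div_le_one (by positivity)]; linarith [(m n).cast_nonneg (α := ℝ)]
    simp only [t]; linarith
  have ht1 : ∀ n, t n < 1 := fun n => by
    have : 0 < 1 / ((m n : ℝ) + 1) := by positivity
    simp only [t]; linarith
  have htmono : ∀ n, t n ≤ t (n + 1) := fun n => by
    have : (m n : ℝ) ≤ m (n + 1) := by exact_mod_cast (hm n.lt_succ_self).le
    simp only [t]; gcongr
  have hsub : ∀ {a b : ℝ}, 0 ≤ a → b < 1 → Icc a b ×ˢ K ⊆ Icc 0 1 ×ˢ K := fun ha hb =>
    prod_mono (Icc_subset_Icc ha hb.le) Subset.rfl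
  have hUab : ∀ {a b : ℝ}, 0 ≤ a → b < 1 → ∀ s ∈ Icc a b, ∀ k ∈ K, Φ s k ∈ U :=
    fun ha hb s hs k hk => hΦU s ⟨ha.trans hs.1, hs.2.trans_lt hb⟩ k hk
  have hblock := fun n => exists_interpolation_along hKc hKs hK0 hU (htmono n)
    (hΦ.mono (hsub (ht0 n) (ht1 _))) (hUab (ht0 n) (ht1 _)) (ω := (1 / 2) ^ n) (by positivity)
    fun s hs k hk => hmΦ n s ⟨hs.1, hs.2.trans (ht1 _).le⟩ (t n) ⟨le_rfl, (ht1 n).le⟩ k hk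
  choose ρ hρ hρf using hblock
  let P : ℕ → (ℂ → ℂ) → Prop := fun n f => InDiscAlgebra f ∧ MapsTo f (closedBall 0 1) U ∧
    ∀ k ∈ K, ‖f k - Φ (t n) k‖ < min (ρ n) ((1 / 2) ^ n)
  have hstart : ∃ f, P 0 f := by
    obtain ⟨C, hC⟩ := hIK.exists_bound_of_continuousOn hΦ
    obtain ⟨ρ', hρ', h⟩ := exists_interpolation_along hKc hKs hK0 hU (ht0 0)
      (hΦ.mono (hsub le_rfl (ht1 0))) (hUab le_rfl (ht1 0)) (ω := 4 * |C| + 1) (by positivity)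
      fun s hs k hk => by
        have h1 := hC (s, k) ⟨⟨hs.1, hs.2.trans (ht1 0).le⟩, hk⟩
        have h2 := hC (0, k) ⟨⟨le_rfl, zero_le_one⟩, hk⟩
        have h3 := norm_sub_le (Φ s k) (Φ 0 k)
        simp only at h1 h2
        linarith [le_abs_self C]
    obtain ⟨f, hf, hfU, hfK, -⟩ := h (fun _ => c) (.const c) (fun _ _ => hc)
      (fun k hk => by simpa [hΦ0 k hk] using hρ') (min (ρ 0) ((1 / 2) ^ 0))
      (lt_min (hρ 0) (by positivity))
    exact ⟨f, hf, hfU, hfK⟩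
  have hnext : ∀ n f, P n f → ∃ f', P (n + 1) f' ∧
      ∀ z ∈ closedBall (0 : ℂ) 1, ‖f' z - f z‖ < (1 / 2) ^ n := fun n f hf => by
    obtain ⟨f', h1, h2, h3, h4⟩ := hρf n f hf.1 hf.2.1
      (fun k hk => (hf.2.2 k hk).trans_le (min_le_left _ _))
      (min (ρ (n + 1)) ((1 / 2) ^ (n + 1))) (lt_min (hρ _) (by positivity))
    exact ⟨f', ⟨h1, h2, h3⟩, h4⟩
  obtain ⟨f₀, hf₀⟩ := hstart
  choose! next hnextP hnextd using hnext
  let f : ℕ → ℂ → ℂ := fun n => Nat.rec f₀ next n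
  have hfP : ∀ n, P n (f n) := fun n => by
    induction n with
    | zero => exact hf₀
    | succ n ih => exact hnextP n _ ih
  obtain ⟨F, hF, hlim⟩ := exists_limit_of_geometric (fun n => (hfP n).1)
    fun n => hnextd n _ (hfP n)
  refine ⟨F, hF, fun z hz => hT.mem_of_tendsto (hlim z hz)
    (Eventually.of_forall fun n => hUT ((hfP n).2.1 hz)), fun k hk => ?_⟩
  have hpow := tendsto_pow_atTop_nhds_zero_of_lt_one (r := (1 / 2 : ℝ)) (by norm_num) (by norm_num)
  have h1 : Tendsto (fun n => f n k - Φ 1 k) atTop (nhds 0) := by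
    refine squeeze_zero_norm (a := fun n => (1 / 2 : ℝ) ^ n + (1 / 2) ^ n / 2) (fun n => ?_) ?_
    · have h2 := (hfP n).2.2 k hk
      have h3 := hmΦ n (t n) ⟨le_rfl, (ht1 n).le⟩ 1 ⟨(ht1 n).le, le_rfl⟩ k hk
      have h4 := norm_sub_le_norm_sub_add_norm_sub (f n k) (Φ (t n) k) (Φ 1 k)
      linarith [min_le_right (ρ n) ((1 / 2) ^ n)]
    · simpa using hpow.add (hpow.div_const 2)
  have h2 := (hlim k (hKD hk)).sub_const (Φ 1 k)
  exact sub_eq_zero.1 (tendsto_nhds_unique h2 h1)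

/-- The Rudin–Carleson interpolation theorem with range constraint. -/
theorem rudin_carleson (K : Set ℂ) (hKc : IsCompact K) (hKs : K ⊆ Metric.sphere (0:ℂ) 1)
    (hK0 : arclength K = 0)
    (φ : ℂ → ℂ) (hφc : ContinuousOn φ K) (hφ1 : ∀ z ∈ K, ‖φ z‖ = 1)
    (T : Set ℂ) (hT : Nonempty (↥T ≃ₜ ↥(Metric.closedBall (0:ℂ) 1)))
    (hφT : φ '' K ⊆ T) :
    ∃ f : ℂ → ℂ, ContinuousOn f (Metric.closedBall (0:ℂ) 1) ∧
      DifferentiableOn ℂ f (Metric.ball (0:ℂ) 1) ∧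
      (∀ z ∈ K, f z = φ z) ∧ f '' Metric.closedBall (0:ℂ) 1 ⊆ T := by
  classical
  obtain ⟨e⟩ := hT
  have hmem : ∀ z, discRetraction z ∈ closedBall (0 : ℂ) 1 := fun z => by
    simpa using norm_discRetraction_le z
  let h : ℂ → ℂ := fun z => (e.symm ⟨discRetraction z, hmem z⟩ : ℂ)
  have hc : Continuous h := continuous_subtype_val.comp
    (e.symm.continuous.comp (continuous_discRetraction.subtype_mk hmem))
  have hhT : ∀ z, h z ∈ T := fun z => (e.symm _).2
  have hi : InjOn h (closedBall 0 1) := fun x hx y hy hxy => by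
    have : discRetraction x = discRetraction y :=
      congrArg Subtype.val (e.symm.injective (Subtype.ext hxy))
    rwa [discRetraction_of_norm_le (by simpa using hx),
      discRetraction_of_norm_le (by simpa using hy)] at this
  have hTc : IsCompact T := by
    have : CompactSpace T := e.symm.compactSpace
    exact isCompact_iff_compactSpace.2 this
  have hφT' : ∀ k ∈ K, φ k ∈ T := fun k hk => hφT (mem_image_of_mem φ hk)
  let g : ℂ → ℂ := fun k => if hk : φ k ∈ T then (e ⟨φ k, hk⟩ : ℂ) else 0
  have hg : ContinuousOn g K := by
    rw [continuousOn_iff_continuous_domRestrict]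
    have : K.domRestrict g = fun k : K => (e ⟨φ k, hφT' k k.2⟩ : ℂ) := by
      funext k
      simp [g, hφT' k k.2]
    rw [this]
    exact continuous_subtype_val.comp (e.continuous.comp (hφc.domRestrict.subtype_mk _))
  have hgD : ∀ k, ‖g k‖ ≤ 1 := fun k => by
    by_cases hk : φ k ∈ T
    · simp only [g, dif_pos hk]
      exact mem_closedBall_zero_iff.1 (e ⟨φ k, hk⟩).2
    · simp [g, hk]
  have hhg : ∀ k ∈ K, h (g k) = φ k := fun k hk => by
    have hk' := hφT' k hk
    have : (⟨discRetraction (g k), hmem _⟩ : closedBall (0 : ℂ) 1) = e ⟨φ k, hk'⟩ := by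
      refine Subtype.ext ?_
      simp only [discRetraction_of_norm_le (hgD k)]
      simp [g, hk']
    simp [h, this]
  obtain ⟨F, hF, hFT, hFK⟩ := exists_interpolation_of_homotopy hKc hKs hK0
    (isOpen_image_ball hc hi) hTc.isClosed (by rintro _ ⟨z, -, rfl⟩; exact hhT z)
    (Φ := fun s k => h (s * g k))
    (hc.comp_continuousOn (ContinuousOn.mul (by fun_prop)
      (hg.comp continuousOn_snd fun p hp => hp.2)))
    (fun s hs k _ => mem_image_of_mem h (by
      rw [mem_ball_zero_iff, norm_mul, norm_real, Real.norm_of_nonneg hs.1]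
      exact (mul_le_of_le_one_right hs.1 (hgD k)).trans_lt hs.2))
    (c := h 0) (mem_image_of_mem h (by simp)) (fun k _ => by simp)
  exact ⟨F, hF.1, hF.2, fun k hk => by simpa [hhg k hk] using hFK k hk, hFT.image_subset⟩
end
end
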